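/- Let n ≥ 2, let S̃_n be Schur's double cover of S_n with projection π, and let g ∈ S̃_n be such that the permutation π(g) has no fixed points, has at least two cycles, and all cycle lengths of π(g) are even and pairwise distinct. Let k = k(g) be the order of π(g). Then for every irreducible spin representation (ρ, V) of S̃_n, the minimal polynomial of ρ(g) equals X^k − ε_g. -/

import Mathlib

/-!
Schur's double cover `S̃_N` of the symmetric group, presented by generators
`z, t_1, …, t_{N-1}` and relations `z² = 1`, `t_i² = z`, `(t_i t_{i+1})³ = z`,
`(t_i t_j)² = z` for `|i − j| ≥ 2`.

Generators are indexed by `Option (Fin (N-1))`: `none` is the central element `z`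
and `some i` is `t_{i+1}` (so `some i` for `i = 0, …, N-2` are `t_1, …, t_{N-1}`).
-/

abbrev SchurGen (N : ℕ) := Option (Fin (N - 1))

namespace Schur

/-- The relator `z` as an element of the free group. -/
def zf (N : ℕ) : FreeGroup (SchurGen N) := FreeGroup.of none

/-- The generator `t_{i+1}` as an element of the free group. -/
def tf (N : ℕ) (i : Fin (N - 1)) : FreeGroup (SchurGen N) := FreeGroup.of (some i)

/-- The defining relators of Schur's double cover. -/
def rels (N : ℕ) : Set (FreeGroup (SchurGen N)) :=
  { r | r = zf N ^ 2 ∨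
        (∃ i, r = tf N i ^ 2 * (zf N)⁻¹) ∨
        (∃ i j : Fin (N - 1), (i : ℕ) + 1 = (j : ℕ) ∧
          r = (tf N i * tf N j) ^ 3 * (zf N)⁻¹) ∨
        (∃ i j : Fin (N - 1), ((i : ℕ) + 2 ≤ (j : ℕ) ∨ (j : ℕ) + 2 ≤ (i : ℕ)) ∧
          r = (tf N i * tf N j) ^ 2 * (zf N)⁻¹) }

/-- Schur's double cover `S̃_N` of the symmetric group `S_N`. -/
abbrev Cover (N : ℕ) := PresentedGroup (rels N)

/-- The central element `z` of `S̃_N`. -/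
def z (N : ℕ) : Cover N := PresentedGroup.of none

/-- The generator `t_{i+1}` of `S̃_N` (0-indexed). -/
def t (N : ℕ) (i : Fin (N - 1)) : Cover N := PresentedGroup.of (some i)

/-- The generator `t_i` of `S̃_N`, 1-indexed: meaningful for `1 ≤ i ≤ N-1`
(junk value `1` outside this range). -/
def T (N i : ℕ) : Cover N := if h : i - 1 < N - 1 then t N ⟨i - 1, h⟩ else 1

/-- The product `t_a t_{a+1} ⋯ t_{a+n-1}` (`n` consecutive generators, 1-indexed). -/
def P (N a n : ℕ) : Cover N := ((List.range n).map fun j => T N (a + j)).prod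

end Schur

/-- The adjacent transposition `(i, i+1)` of `{1, …, n}`: in 0-indexed terms, for
`i : Fin (n-1)` this is the swap of `i` and `i+1` in `Fin n`.  It is the image of the
generator `t_{i+1}` under the canonical projection `S̃_n → S_n`. -/
def Schur.adj (n : ℕ) (i : Fin (n - 1)) : Equiv.Perm (Fin n) :=
  Equiv.swap ⟨i.1, by have := i.2; omega⟩ ⟨i.1 + 1, by have := i.2; omega⟩

namespace CoxeterA

variable {Q : Type*} [Group Q]

/-- The descending product `s (i+k-1) ⋯ s (i+1) s i`. -/
def descProd (s : ℕ → Q) (i : ℕ) : ℕ → Q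
  | 0 => 1
  | k + 1 => s (i + k) * descProd s i k

variable {s : ℕ → Q}

theorem descProd_mul_of_lt (hc : ∀ i j, i + 2 ≤ j → s i * s j = s j * s i) {i m : ℕ}
    (h : m + 1 < i) (k : ℕ) : descProd s i k * s m = s m * descProd s i k := by
  induction k with
  | zero => simp [descProd]
  | succ k ih =>
    rw [descProd, mul_assoc, ih, ← mul_assoc, ← hc m (i + k) (by omega), mul_assoc]

theorem descProd_mul_of_gt (hc : ∀ i j, i + 2 ≤ j → s i * s j = s j * s i) {i m : ℕ}
    (k : ℕ) (h : i + k < m) : descProd s i k * s m = s m * descProd s i k := by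
  induction k with
  | zero => simp [descProd]
  | succ k ih =>
    rw [descProd, mul_assoc, ih (by omega), ← mul_assoc, hc (i + k) m (by omega), mul_assoc]

theorem descProd_succ_mul (m k : ℕ) : descProd s (m + 1) k * s m = descProd s m (k + 1) := by
  induction k with
  | zero => simp [descProd]
  | succ k ih =>
    rw [descProd, mul_assoc, ih, descProd, descProd, descProd]
    congr 2; omega

theorem descProd_mul_between (hc : ∀ i j, i + 2 ≤ j → s i * s j = s j * s i) {N : ℕ}
    (hb : ∀ i, i + 1 < N → s (i + 1) * s i * s (i + 1) = s i * s (i + 1) * s i)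
    {i m : ℕ} (k : ℕ) (h1 : i < m + 1) (h2 : m + 1 < i + k) (hN : i + k ≤ N) :
    descProd s i k * s (m + 1) = s m * descProd s i k := by
  induction k with
  | zero => omega
  | succ k ih =>
    rcases Nat.lt_or_ge (m + 1) (i + k) with h | h
    · rw [descProd, mul_assoc, ih h (by omega), ← mul_assoc, ← hc m (i + k) (by omega), mul_assoc]
    · obtain ⟨k, rfl⟩ : ∃ k', k = k' + 1 := ⟨k - 1, by omega⟩
      obtain rfl : m = i + k := by omega
      have hk := descProd_mul_of_gt hc k (show i + k < i + k + 1 by omega)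
      rw [descProd, descProd, mul_assoc, mul_assoc, hk, ← mul_assoc, ← mul_assoc,
        show i + (k + 1) = i + k + 1 by omega, hb _ (by omega)]
      simp only [mul_assoc]

theorem exists_descProd (hs : ∀ i, s i * s i = 1)
    (hc : ∀ i j, i + 2 ≤ j → s i * s j = s j * s i) {N : ℕ}
    (hb : ∀ i, i + 1 < N → s (i + 1) * s i * s (i + 1) = s i * s (i + 1) * s i)
    {j : ℕ} (hj : j < N) {x : Q} (hx : x ∈ Subgroup.closure (s '' Set.Iio (j + 1))) :
    ∃ y ∈ Subgroup.closure (s '' Set.Iio j), ∃ i k, i + k = j + 1 ∧ x = y * descProd s i k := by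
  have key : ∀ x, (∃ y ∈ Subgroup.closure (s '' Set.Iio j), ∃ i k, i + k = j + 1 ∧
      x = y * descProd s i k) → ∀ m < j + 1, ∃ y ∈ Subgroup.closure (s '' Set.Iio j), ∃ i k,
        i + k = j + 1 ∧ x * s m = y * descProd s i k := by
    rintro x ⟨y, hy, i, k, hik, rfl⟩ m hm
    have mem : ∀ m < j, y * s m ∈ Subgroup.closure (s '' Set.Iio j) := fun m hm =>
      mul_mem hy (Subgroup.subset_closure ⟨m, hm, rfl⟩)
    rcases lt_trichotomy m i with h | h | h
    · rcases Nat.lt_or_ge (m + 1) i with h' | h'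
      · exact ⟨y * s m, mem m (by omega), i, k, hik, by
          rw [mul_assoc, descProd_mul_of_lt hc h', mul_assoc]⟩
      · obtain rfl : i = m + 1 := by omega
        exact ⟨y, hy, m, k + 1, by omega, by rw [mul_assoc, descProd_succ_mul]⟩
    · subst h
      obtain ⟨k, rfl⟩ : ∃ k', k = k' + 1 := ⟨k - 1, by omega⟩
      exact ⟨y, hy, m + 1, k, by omega, by
        rw [mul_assoc, ← descProd_succ_mul, mul_assoc, hs, mul_one]⟩
    · obtain ⟨m, rfl⟩ : ∃ m', m = m' + 1 := ⟨m - 1, by omega⟩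
      exact ⟨y * s m, mem m (by omega), i, k, hik, by
        rw [mul_assoc, descProd_mul_between hc hb k h (by omega) (by omega), mul_assoc]⟩
  induction hx using Subgroup.closure_induction_right with
  | one => exact ⟨1, one_mem _, j + 1, 0, rfl, by simp [descProd]⟩
  | mul_right x _ y hy ih =>
    obtain ⟨m, hm, rfl⟩ := hy
    exact key x ih m hm
  | mul_inv_cancel x _ y hy ih =>
    obtain ⟨m, hm, rfl⟩ := hy
    rw [inv_eq_of_mul_eq_one_left (hs m)]
    exact key x ih m hm

theorem eq_one_of_map_eq_one (hs : ∀ i, s i * s i = 1)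
    (hc : ∀ i j, i + 2 ≤ j → s i * s j = s j * s i) {N : ℕ}
    (hb : ∀ i, i + 1 < N → s (i + 1) * s i * s (i + 1) = s i * s (i + 1) * s i)
    (f : Q →* Equiv.Perm ℕ) (hf : ∀ i < N, f (s i) = Equiv.swap i (i + 1))
    {j : ℕ} (hj : j ≤ N) {x : Q} (hx : x ∈ Subgroup.closure (s '' Set.Iio j)) (h1 : f x = 1) :
    x = 1 := by
  induction j generalizing x with
  | zero => simpa using hx
  | succ j ih =>
    obtain ⟨y, hy, i, k, hik, rfl⟩ := exists_descProd hs hc hb hj hx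
    rcases k with _ | k
    · simp only [descProd, mul_one] at h1 ⊢
      exact ih (by omega) hy h1
    · exfalso
      have hfix : f y (j + 1) = j + 1 := by
        clear hx h1 ih
        induction hy using Subgroup.closure_induction_right with
        | one => simp
        | mul_right x _ y hy ih =>
          obtain ⟨m, hm, rfl⟩ := hy
          have hm' : m < j := hm
          rw [map_mul, hf m (by omega), Equiv.Perm.mul_apply,
            Equiv.swap_apply_of_ne_of_ne (by omega) (by omega), ih]
        | mul_inv_cancel x _ y hy ih =>
          obtain ⟨m, hm, rfl⟩ := hy
          have hm' : m < j := hm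
          rw [inv_eq_of_mul_eq_one_left (hs m), map_mul, hf m (by omega), Equiv.Perm.mul_apply,
            Equiv.swap_apply_of_ne_of_ne (by omega) (by omega), ih]
      have hD : ∀ k, i + k ≤ j + 1 → f (descProd s i k) i = i + k := by
        intro k hk
        induction k with
        | zero => simp [descProd]
        | succ k ih =>
          rw [descProd, map_mul, Equiv.Perm.mul_apply, ih (by omega), hf _ (by omega),
            Equiv.swap_apply_left]; rfl
      have := congrArg (fun e => e i) h1
      simp only [map_mul, Equiv.Perm.mul_apply, hD (k + 1) hik.le, hik, hfix,
        Equiv.Perm.one_apply] at this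
      omega

end CoxeterA

section

open Equiv

theorem Equiv.Perm.swap_mul_swap_mul_swap_mul_swap {α : Type*} [DecidableEq α] {x y w u : α}
    (hxy : x ≠ y) (hxw : x ≠ w) (hyw : y ≠ w)
    (hux : u ≠ x) (huy : u ≠ y) (huw : u ≠ w) :
    swap x y * swap w u * (swap y w * swap x u) = swap x w * swap y u := by
  have := hxy.symm
  have := hxw.symm
  have := hyw.symm
  have := hux.symm
  have := huy.symm
  have := huw.symm
  ext t
  simp only [Perm.mul_apply, swap_apply_def]
  by_cases h1 : t = x
  · subst h1; simp only [*, if_true, if_false]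
  by_cases h2 : t = y
  · subst h2; simp only [*, if_true, if_false]
  by_cases h3 : t = w
  · subst h3; simp only [*, if_true, if_false]
  by_cases h4 : t = u
  · subst h4; simp only [*, if_true, if_false]
  simp only [*, if_false]

theorem MonoidHom.map_conj_pow_add {G H : Type*} [Group G] [Group H] {π : G →* H} {c d : G}
    {r : ℕ} (h : Commute (π c ^ r) (π d)) (j : ℕ) :
    π (c ^ (j + r) * d * (c ^ (j + r))⁻¹) = π (c ^ j * d * (c ^ j)⁻¹) := by
  simp only [map_mul, map_inv, map_pow, pow_add, mul_inv_rev]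
  rw [mul_assoc (π c ^ j), h.eq]
  simp only [mul_assoc, mul_inv_cancel_left]

/-- The properties of a projection `π` onto a symmetric group and of a representation `ρ` that
encode that `ρ` is a spin representation. -/
structure IsSpin {G α V : Type*} [Group G] [Fintype α] [DecidableEq α] [AddCommGroup V]
    [Module ℂ V] (π : G →* Perm α) (ρ : G →* Module.End ℂ V) : Prop where
  surj : Function.Surjective π
  ker : ∀ a, π a = 1 → ρ a = 1 ∨ ρ a = -1
  swap_sq : ∀ a x y, x ≠ y → π a = swap x y → ρ a * ρ a = -1
  swap_anti : ∀ a b, (π a).IsSwap → (π b).IsSwap → (π a).Disjoint (π b) →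
    ρ a * ρ b = -(ρ b * ρ a)

namespace Schur

variable {n : ℕ}

theorem z_sq : z n * z n = 1 := by
  have h : PresentedGroup.mk (rels n) (zf n ^ 2) = 1 :=
    PresentedGroup.one_of_mem (Or.inl rfl)
  rw [map_pow, pow_two] at h
  exact h

theorem t_sq (i : Fin (n - 1)) : t n i * t n i = z n := by
  have h : PresentedGroup.mk (rels n) (tf n i ^ 2 * (zf n)⁻¹) = 1 :=
    PresentedGroup.one_of_mem (Or.inr (Or.inl ⟨i, rfl⟩))
  rw [map_mul, map_inv, mul_inv_eq_one, map_pow, pow_two] at h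
  exact h

theorem t_braid {i j : Fin (n - 1)} (hij : (i : ℕ) + 1 = j) : (t n i * t n j) ^ 3 = z n := by
  have h : PresentedGroup.mk (rels n) ((tf n i * tf n j) ^ 3 * (zf n)⁻¹) = 1 :=
    PresentedGroup.one_of_mem (Or.inr (Or.inr (Or.inl ⟨i, j, hij, rfl⟩)))
  rw [map_mul, map_inv, mul_inv_eq_one, map_pow, map_mul] at h
  exact h

theorem t_anti {i j : Fin (n - 1)} (hij : (i : ℕ) + 2 ≤ j ∨ (j : ℕ) + 2 ≤ i) :
    (t n i * t n j) ^ 2 = z n := by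
  have h : PresentedGroup.mk (rels n) ((tf n i * tf n j) ^ 2 * (zf n)⁻¹) = 1 :=
    PresentedGroup.one_of_mem (Or.inr (Or.inr (Or.inr ⟨i, j, hij, rfl⟩)))
  rw [map_mul, map_inv, mul_inv_eq_one, map_pow, map_mul] at h
  exact h

theorem closure_gens : Subgroup.closure (Set.range (PresentedGroup.of (rels := rels n))) = ⊤ :=
  PresentedGroup.closure_range_of _

theorem z_central (a : Cover n) : a * z n = z n * a := by
  have ha : a ∈ Subgroup.centralizer {z n} := by
    have : (⊤ : Subgroup (Cover n)) ≤ Subgroup.centralizer {z n} := by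
      rw [← closure_gens, Subgroup.closure_le]
      rintro _ ⟨_ | i, rfl⟩
      · rw [SetLike.mem_coe, Subgroup.mem_centralizer_singleton_iff]; rfl
      · rw [SetLike.mem_coe, Subgroup.mem_centralizer_singleton_iff]
        change t n i * z n = z n * t n i
        rw [← t_sq i, mul_assoc]
    exact this trivial
  exact Subgroup.mem_centralizer_singleton_iff.1 ha

instance zpowers_z_normal : (Subgroup.zpowers (z n)).Normal := by
  constructor
  rintro _ ⟨k, rfl⟩ g
  have : Commute g (z n ^ k) := (show Commute g (z n) from z_central g).zpow_right k
  change g * z n ^ k * g⁻¹ ∈ _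
  rw [this.eq, mul_assoc, mul_inv_cancel, mul_one]
  exact ⟨k, rfl⟩

theorem mem_zpowers_z {a : Cover n} (ha : a ∈ Subgroup.zpowers (z n)) : a = 1 ∨ a = z n := by
  obtain ⟨k, rfl⟩ := ha
  have h2 : z n ^ (2 : ℤ) = 1 := by rw [zpow_two, z_sq]
  obtain ⟨m, rfl | rfl⟩ := Int.even_or_odd' k
  · left; change z n ^ (2 * m) = 1; rw [zpow_mul, h2, one_zpow]
  · right; change z n ^ (2 * m + 1) = z n; rw [zpow_add, zpow_mul, h2, one_zpow, one_mul, zpow_one]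

variable {π : Cover n →* Perm (Fin n)}

theorem eq_one_or_eq_z (hn : 2 ≤ n) (hπt : ∀ i, π (t n i) = adj n i) (hπz : π (z n) = 1)
    {a : Cover n} (ha : π a = 1) : a = 1 ∨ a = z n := by
  apply mem_zpowers_z
  rw [← QuotientGroup.eq_one_iff]
  let q : Cover n →* Cover n ⧸ Subgroup.zpowers (z n) := QuotientGroup.mk' _
  have hqz : q (z n) = 1 := (QuotientGroup.eq_one_iff _).2 (Subgroup.mem_zpowers _)
  let s : ℕ → Cover n ⧸ Subgroup.zpowers (z n) :=
    fun i => if h : i < n - 1 then q (t n ⟨i, h⟩) else 1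
  let f : Cover n ⧸ Subgroup.zpowers (z n) →* Perm ℕ :=
    (Perm.viaEmbeddingHom Fin.valEmbedding).comp (QuotientGroup.lift _ π (by
      rintro _ ⟨k, rfl⟩
      change π (z n ^ k) = 1
      rw [map_zpow, hπz, one_zpow]))
  have hs : ∀ i, s i * s i = 1 := by
    intro i
    by_cases h : i < n - 1
    · simp only [s, h, dif_pos, ← map_mul, t_sq, hqz]
    · simp [s, h]
  have hinv : ∀ i, (s i)⁻¹ = s i := fun i => inv_eq_of_mul_eq_one_left (hs i)
  refine CoxeterA.eq_one_of_map_eq_one (s := s) (N := n - 1) hs ?_ ?_ f ?_ le_rfl ?_ ?_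
  · intro i j hij
    by_cases h : j < n - 1
    · have h' : i < n - 1 := by omega
      have h2 : (s i * s j) ^ 2 = 1 := by
        simp only [s, h, h', dif_pos]
        rw [← map_mul, ← map_pow, t_anti (Or.inl hij), hqz]
      have h3 : (s i * s j)⁻¹ = s i * s j :=
        inv_eq_of_mul_eq_one_left (by rw [← pow_two, h2])
      rw [mul_inv_rev, hinv, hinv] at h3
      exact h3.symm
    · simp [s, h]
  · intro i hi
    have h' : i < n - 1 := by omega
    have h2 : (s i * s (i + 1)) ^ 3 = 1 := by
      simp only [s, hi, h', dif_pos]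
      rw [← map_mul, ← map_pow, t_braid rfl, hqz]
    have h3 : (s i * s (i + 1) * s i)⁻¹ = s (i + 1) * s i * s (i + 1) := by
      rw [inv_eq_iff_mul_eq_one, ← h2]
      simp only [pow_succ, pow_zero, one_mul, mul_assoc]
    rw [← h3]
    simp only [mul_inv_rev, hinv, mul_assoc]
  · intro i hi
    have : f (s i) = Perm.viaEmbedding (adj n ⟨i, hi⟩) Fin.valEmbedding := by
      simp only [s, hi, dif_pos, f, MonoidHom.comp_apply, Perm.viaEmbeddingHom_apply, ← hπt]
      rfl
    rw [this]
    ext m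
    by_cases hm : m < n
    · have e := Perm.viaEmbedding_apply (adj n ⟨i, hi⟩) Fin.valEmbedding ⟨m, hm⟩
      simp only [Fin.valEmbedding_apply] at e
      rw [e, adj]
      simp only [swap_apply_def, Fin.mk.injEq]
      split_ifs <;> rfl
    · rw [Perm.viaEmbedding_apply_of_notMem _ _ _ (by
        rintro ⟨x, rfl⟩; exact hm x.2), swap_apply_of_ne_of_ne (by omega) (by omega)]
  · have : (⊤ : Subgroup (Cover n)) ≤
        (Subgroup.closure (s '' Set.Iio (n - 1))).comap q := by
      rw [← closure_gens, Subgroup.closure_le]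
      rintro _ ⟨_ | i, rfl⟩
      · change q (z n) ∈ Subgroup.closure (s '' Set.Iio (n - 1))
        rw [hqz]; exact one_mem _
      · refine Subgroup.subset_closure ⟨i, i.2, ?_⟩
        simp only [s, i.2, dif_pos]; rfl
    exact this (Subgroup.mem_top a)
  · change Perm.viaEmbeddingHom Fin.valEmbedding (π a) = 1
    rw [ha, map_one]

theorem surjective_of_gens (hn : 2 ≤ n) (hπt : ∀ i, π (t n i) = adj n i) :
    Function.Surjective π := by
  obtain ⟨m, rfl⟩ : ∃ m, n = m + 1 := ⟨n - 1, by omega⟩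
  rw [← MonoidHom.mrange_eq_top, eq_top_iff, ← Perm.mclosure_swap_castSucc_succ,
    Submonoid.closure_le]
  rintro _ ⟨i, rfl⟩
  exact ⟨t (m + 1) i, by rw [hπt]; rfl⟩

theorem isSpin (hn : 2 ≤ n) (hπt : ∀ i, π (t n i) = adj n i) (hπz : π (z n) = 1)
    {V : Type*} [AddCommGroup V] [Module ℂ V] (ρ : Cover n →* Module.End ℂ V)
    (hspin : ρ (z n) = -1) : IsSpin π ρ := by
  have hsurj := surjective_of_gens hn hπt
  have hker : ∀ a, π a = 1 → ρ a = 1 ∨ ρ a = -1 := by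
    intro a ha
    rcases eq_one_or_eq_z hn hπt hπz ha with rfl | rfl
    · exact Or.inl (map_one ρ)
    · exact Or.inr hspin
  have hlift : ∀ a b, π a = π b → ρ a = ρ b ∨ ρ a = -ρ b := by
    intro a b hab
    rcases hker (a * b⁻¹) (by rw [map_mul, map_inv, hab, mul_inv_cancel]) with h | h
    · left
      rw [← inv_mul_cancel_right a b, map_mul, h, one_mul]
    · right
      rw [← inv_mul_cancel_right a b, map_mul, h, neg_one_mul]
  have hinv : ∀ a, ρ a⁻¹ * ρ a = 1 := fun a => by rw [← map_mul, inv_mul_cancel, map_one]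
  have hinv' : ∀ a, ρ a * ρ a⁻¹ = 1 := fun a => by rw [← map_mul, mul_inv_cancel, map_one]
  refine ⟨hsurj, hker, ?_, ?_⟩
  · intro a x y hxy ha
    have h01 : (⟨0, by omega⟩ : Fin n) ≠ ⟨1, by omega⟩ := by simp
    obtain ⟨c, hc⟩ := isConj_iff.1 (Perm.isConj_swap h01 hxy)
    obtain ⟨h, rfl⟩ := hsurj c
    have e : π a = π (h * t n ⟨0, by omega⟩ * h⁻¹) := by
      rw [ha, map_mul, map_mul, map_inv, hπt, ← hc]; rfl
    have e2 : ρ (h * t n ⟨0, by omega⟩ * h⁻¹) * ρ (h * t n ⟨0, by omega⟩ * h⁻¹) = -1 := by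
      rw [← map_mul, show h * t n ⟨0, by omega⟩ * h⁻¹ * (h * t n ⟨0, by omega⟩ * h⁻¹) =
        h * (t n ⟨0, by omega⟩ * t n ⟨0, by omega⟩) * h⁻¹ by group, t_sq, z_central,
        mul_assoc, mul_inv_cancel, mul_one, hspin]
    rcases hlift _ _ e with e | e <;> rw [e]
    · exact e2
    · rw [neg_mul_neg, e2]
  · rintro a b ⟨x, y, hxy, ha⟩ ⟨u, w, huw, hb⟩ hab
    rw [ha, hb] at hab
    have hd := Perm.disjoint_iff_disjoint_support.1 hab
    rw [Perm.support_swap hxy, Perm.support_swap huw] at hd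
    simp only [Finset.disjoint_insert_left, Finset.mem_insert, Finset.mem_singleton, not_or,
      Finset.disjoint_singleton_left] at hd
    have hn4 : 4 ≤ n := by
      have : ({x, y, u, w} : Finset (Fin n)).card = 4 := by
        rw [Finset.card_insert_of_notMem (by simp; tauto),
          Finset.card_insert_of_notMem (by simp; tauto), Finset.card_pair huw]
      have h2 := Finset.card_le_univ ({x, y, u, w} : Finset (Fin n))
      rw [this, Fintype.card_fin] at h2
      exact h2
    let e1 : Fin 4 ↪ Fin n := Fin.castLEEmb hn4
    let e2 : Fin 4 ↪ Fin n := ⟨![x, y, u, w], by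
      intro p q h
      fin_cases p <;> fin_cases q <;> simp_all⟩
    have := Perm.isMultiplyPretransitive (Fin n) 4
    obtain ⟨c, hc⟩ := MulAction.exists_smul_eq (Perm (Fin n)) e1 e2
    obtain ⟨h, rfl⟩ := hsurj c
    have hc' : ∀ i, π h (e1 i) = e2 i := fun i => DFunLike.congr_fun hc i
    have c0 : π h ⟨0, by omega⟩ = x := hc' 0
    have c1 : π h ⟨1, by omega⟩ = y := hc' 1
    have c2 : π h ⟨2, by omega⟩ = u := hc' 2
    have c3 : π h ⟨3, by omega⟩ = w := hc' 3
    have ea : π a = π (h * t n ⟨0, by omega⟩ * h⁻¹) := by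
      rw [ha, map_mul, map_mul, map_inv, hπt, ← c0, ← c1]
      exact swap_apply_apply _ _ _
    have eb : π b = π (h * t n ⟨2, by omega⟩ * h⁻¹) := by
      rw [hb, map_mul, map_mul, map_inv, hπt, ← c2, ← c3]
      exact swap_apply_apply _ _ _
    have e0 : ρ (t n ⟨0, by omega⟩) * ρ (t n ⟨2, by omega⟩) =
        -(ρ (t n ⟨2, by omega⟩) * ρ (t n ⟨0, by omega⟩)) := by
      have h2 := t_anti (n := n) (i := ⟨0, by omega⟩) (j := ⟨2, by omega⟩) (Or.inl le_rfl)
      have h0 := t_sq (n := n) ⟨0, by omega⟩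
      have h1 := t_sq (n := n) ⟨2, by omega⟩
      have h3 := congrArg ρ (show t n ⟨0, by omega⟩ * t n ⟨2, by omega⟩ =
        z n * (t n ⟨2, by omega⟩ * t n ⟨0, by omega⟩) by
          refine mul_left_cancel (a := t n ⟨0, by omega⟩ * t n ⟨2, by omega⟩) ?_
          rw [← pow_two, h2, ← mul_assoc, z_central, mul_assoc,
            mul_assoc (t n ⟨0, by omega⟩) (t n ⟨2, by omega⟩), ← mul_assoc (t n ⟨2, by omega⟩)
            (t n ⟨2, by omega⟩), h1, ← z_central, ← mul_assoc, mul_assoc (t n ⟨0, by omega⟩) (z n),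
            ← z_central, ← mul_assoc, h0, z_sq, one_mul])
      simpa only [map_mul, hspin, neg_one_mul] using h3
    have key : ρ (h * t n ⟨0, by omega⟩ * h⁻¹) * ρ (h * t n ⟨2, by omega⟩ * h⁻¹) =
        -(ρ (h * t n ⟨2, by omega⟩ * h⁻¹) * ρ (h * t n ⟨0, by omega⟩ * h⁻¹)) := by
      have hm : ∀ p q : Cover n, ρ (h * p * h⁻¹) * ρ (h * q * h⁻¹) =
          ρ h * (ρ p * ρ q) * ρ h⁻¹ := by
        intro p q
        simp only [← map_mul]
        congr 1; group
      rw [hm, hm, e0, mul_neg, neg_mul]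
    rcases hlift _ _ ea with h1 | h1 <;> rcases hlift _ _ eb with h2 | h2 <;> rw [h1, h2] <;>
      simp only [neg_mul, mul_neg, neg_neg, key]

end Schur

namespace IsSpin

variable {G α V : Type*} [Group G] [Fintype α] [DecidableEq α] [AddCommGroup V] [Module ℂ V]
  {π : G →* Perm α} {ρ : G →* Module.End ℂ V}

theorem rho_mul_apply (a b : G) (v : V) : ρ (a * b) v = ρ a (ρ b v) := by
  rw [map_mul]; rfl

theorem rho_inv_apply (a : G) (v : V) : ρ a⁻¹ (ρ a v) = v := by
  rw [← rho_mul_apply, inv_mul_cancel, map_one]; rfl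

theorem rho_apply_inv (a : G) (v : V) : ρ a (ρ a⁻¹ v) = v := by
  rw [← rho_mul_apply, mul_inv_cancel, map_one]; rfl

theorem rho_ne_zero (a : G) {v : V} (hv : v ≠ 0) : ρ a v ≠ 0 := fun h => hv <| by
  rw [← rho_inv_apply (ρ := ρ) a v, h, map_zero]

theorem rho_inv_eigen {a : G} {v : V} {μ : ℂ} (hμ : μ ≠ 0) (h : ρ a v = μ • v) :
    ρ a⁻¹ v = μ⁻¹ • v := by
  have : ρ a⁻¹ (ρ a v) = v := rho_inv_apply a v
  rw [h, map_smul] at this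
  rw [← this, smul_smul, inv_mul_cancel₀ hμ, one_smul, this]

theorem rho_pow_eigen {a : G} {v : V} {μ : ℂ} (h : ρ a v = μ • v) (k : ℕ) :
    ρ (a ^ k) v = μ ^ k • v := by
  induction k with
  | zero => simp
  | succ k ih => rw [pow_succ', rho_mul_apply, ih, map_smul, h, smul_smul, pow_succ]

theorem eigen_ne_zero {a : G} {v : V} (hv : v ≠ 0) {μ : ℂ} (h : ρ a v = μ • v) : μ ≠ 0 := by
  rintro rfl
  exact rho_ne_zero a hv (by rw [h, zero_smul])

/-- `W` is preserved by all elements that act inside `D`. -/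
def Inv (π : G →* Perm α) (ρ : G →* Module.End ℂ V) (W : Submodule ℂ V) (D : Finset α) : Prop :=
  ∀ a, (π a).support ⊆ D → ∀ v ∈ W, ρ a v ∈ W

/-- `W` is preserved by all elements over even permutations that act inside `D`. -/
def EInv (π : G →* Perm α) (ρ : G →* Module.End ℂ V) (W : Submodule ℂ V) (D : Finset α) : Prop :=
  ∀ a, (π a).support ⊆ D → (π a).sign = 1 → ∀ v ∈ W, ρ a v ∈ W

theorem Inv.mono {W : Submodule ℂ V} {D E : Finset α} (h : Inv π ρ W D) (hE : E ⊆ D) :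
    Inv π ρ W E := fun a ha => h a (ha.trans hE)

theorem Inv.eInv {W : Submodule ℂ V} {D : Finset α} (h : Inv π ρ W D) : EInv π ρ W D :=
  fun a ha _ => h a ha

theorem lift_eq (S : IsSpin π ρ) {a b : G} (hab : π a = π b) : ρ a = ρ b ∨ ρ a = -ρ b := by
  rcases S.ker (a * b⁻¹) (by rw [map_mul, map_inv, hab, mul_inv_cancel]) with h | h
  · left
    rw [← inv_mul_cancel_right a b, map_mul, h, one_mul]
  · right
    rw [← inv_mul_cancel_right a b, map_mul, h, neg_one_mul]

theorem lift_mul_self (S : IsSpin π ρ) {a b : G} (hab : π a = π b) :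
    ρ a * ρ a = ρ b * ρ b := by
  rcases S.lift_eq hab with h | h <;> rw [h]
  rw [neg_mul_neg]

/-- Elements inside `D` commute with `T` up to a sign if this holds for transpositions. -/
theorem smul_comm_of_swap (S : IsSpin π ρ) (T : Module.End ℂ V) (D : Finset α) (c : ℂ)
    (hc : c * c = 1)
    (h : ∀ a, (π a).IsSwap → (π a).support ⊆ D → ρ a * T = c • (T * ρ a)) {a : G}
    (ha : (π a).support ⊆ D) :
    ρ a * T = (if (π a).sign = 1 then (1 : ℂ) else c) • (T * ρ a) := by
  have key : ∀ f : Perm D, ∀ a, π a = Perm.ofSubtype f →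
      ρ a * T = (if (π a).sign = 1 then (1 : ℂ) else c) • (T * ρ a) := by
    intro f
    induction f using Perm.swap_induction_on with
    | one =>
      intro a ha
      rw [map_one] at ha
      rw [ha, map_one, if_pos rfl, one_smul]
      rcases S.ker a ha with h | h <;> rw [h]
      · rw [one_mul, mul_one]
      · rw [neg_one_mul, mul_neg_one]
    | swap_mul f x y hxy ih =>
      intro a ha
      obtain ⟨s, hs⟩ := S.surj (Perm.ofSubtype (swap x y))
      have hb : π (s⁻¹ * a) = Perm.ofSubtype f := by
        rw [map_mul, map_inv, hs, ha, map_mul, inv_mul_cancel_left]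
      have h1 := ih _ hb
      have hs' : π s = swap (x : α) y := by rw [hs, Perm.ofSubtype_swap_eq]
      have hxy' : (x : α) ≠ y := fun e => hxy (Subtype.ext e)
      have h2 := h s ⟨x, y, hxy', hs'⟩ (by
        rw [hs', Perm.support_swap hxy']
        intro t ht
        simp only [Finset.mem_insert, Finset.mem_singleton] at ht
        rcases ht with rfl | rfl
        · exact x.2
        · exact y.2)
      have hsg : (π a).sign = -(π (s⁻¹ * a)).sign := by
        rw [hb, ha, map_mul, Perm.sign_mul, ← hs, hs', Perm.sign_swap hxy', neg_one_mul]
      have ha' : ρ a = ρ s * ρ (s⁻¹ * a) := by rw [← map_mul, mul_inv_cancel_left]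
      rw [ha', mul_assoc, h1, mul_smul_comm, ← mul_assoc, h2, smul_mul_assoc, smul_smul,
        mul_assoc, hsg]
      congr 1
      rcases Int.units_eq_one_or (π (s⁻¹ * a)).sign with h | h <;> rw [h] <;> simp [hc]
  obtain ⟨f, hf⟩ : ∃ f : Perm D, π a = Perm.ofSubtype f := by
    have : π a ∈ (Perm.ofSubtype : Perm D →* Perm α).range :=
      (Perm.mem_range_ofSubtype_iff).2 ha
    obtain ⟨f, hf⟩ := this
    exact ⟨f, hf.symm⟩
  exact key f a hf

theorem disjoint_comm (S : IsSpin π ρ) {a b : G} (hab : (π a).Disjoint (π b)) :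
    ρ a * ρ b = (if (π a).sign = 1 then (1 : ℂ) else if (π b).sign = 1 then 1 else -1) •
      (ρ b * ρ a) := by
  refine S.smul_comm_of_swap (ρ b) (π a).support _ (by split_ifs <;> norm_num) ?_ subset_rfl
  intro s hs hsD
  have hsb : Disjoint (π b).support (π s).support :=
    (Perm.disjoint_iff_disjoint_support.1 hab).symm.mono_right hsD
  have := S.smul_comm_of_swap (ρ s) (π b).support (-1) (by norm_num) (by
    intro t ht htD
    rw [S.swap_anti t s ht hs (Perm.disjoint_iff_disjoint_support.2 (hsb.mono_left htD)),
      neg_one_smul]) subset_rfl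
  rw [this, smul_smul]
  split_ifs <;> simp

theorem comm_of_sign_left (S : IsSpin π ρ) {a b : G} (hab : (π a).Disjoint (π b))
    (ha : (π a).sign = 1) : ρ a * ρ b = ρ b * ρ a := by
  rw [S.disjoint_comm hab, if_pos ha, one_smul]

theorem comm_of_sign_right (S : IsSpin π ρ) {a b : G} (hab : (π a).Disjoint (π b))
    (hb : (π b).sign = 1) : ρ a * ρ b = ρ b * ρ a :=
  (S.comm_of_sign_left hab.symm hb).symm

theorem anticomm (S : IsSpin π ρ) {a b : G} (hab : (π a).Disjoint (π b))
    (ha : (π a).sign = -1) (hb : (π b).sign = -1) : ρ a * ρ b = -(ρ b * ρ a) := by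
  rw [S.disjoint_comm hab, ha, hb, if_neg (by decide), if_neg (by decide), neg_one_smul]

theorem double_sq (S : IsSpin π ρ) {a : G} {x y u w : α} (hxy : x ≠ y) (huw : u ≠ w)
    (hd : (swap x y).Disjoint (swap u w)) (ha : π a = swap x y * swap u w) :
    ρ a * ρ a = -1 := by
  obtain ⟨s, hs⟩ := S.surj (swap x y)
  obtain ⟨t, ht⟩ := S.surj (swap u w)
  rw [S.lift_mul_self (b := s * t) (by rw [ha, map_mul, hs, ht]), map_mul, mul_assoc,
    ← mul_assoc (ρ t), S.anticomm (a := t) (b := s) (by rw [hs, ht]; exact hd.symm)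
      (by rw [ht, Perm.sign_swap huw]) (by rw [hs, Perm.sign_swap hxy]), neg_mul, mul_neg,
    mul_assoc, S.swap_sq t u w huw ht, ← mul_assoc, S.swap_sq s x y hxy hs, neg_mul_neg, one_mul]

theorem inv_inf_eigenspace (S : IsSpin π ρ) {W : Submodule ℂ V} {D E : Finset α} {y : G}
    (hy : (π y).sign = 1) (hW : Inv π ρ W D) (hE : E ⊆ D) (hEy : Disjoint (π y).support E)
    (μ : ℂ) : Inv π ρ (W ⊓ (ρ y).eigenspace μ) E := by
  rintro a ha v ⟨hv, hv'⟩
  refine ⟨hW a (ha.trans hE) v hv, ?_⟩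
  rw [SetLike.mem_coe, Module.End.mem_eigenspace_iff] at hv' ⊢
  have := S.comm_of_sign_left (a := y) (b := a)
    (Perm.disjoint_iff_disjoint_support.2 (hEy.mono_right ha)) hy
  rw [← Module.End.mul_apply, this, Module.End.mul_apply, hv', map_smul]

theorem eInv_inf_eigenspace (S : IsSpin π ρ) {W : Submodule ℂ V} {D E : Finset α} {y : G}
    (hW : EInv π ρ W D) (hE : E ⊆ D) (hEy : Disjoint (π y).support E)
    (μ : ℂ) : EInv π ρ (W ⊓ (ρ y).eigenspace μ) E := by
  rintro a ha has v ⟨hv, hv'⟩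
  refine ⟨hW a (ha.trans hE) has v hv, ?_⟩
  rw [SetLike.mem_coe, Module.End.mem_eigenspace_iff] at hv' ⊢
  have := S.comm_of_sign_right (a := y) (b := a)
    (Perm.disjoint_iff_disjoint_support.2 (hEy.mono_right ha)) has
  rw [← Module.End.mul_apply, this, Module.End.mul_apply, hv', map_smul]

/-- An odd cycle anticommutes with an even element of which it is a cycle factor. -/
theorem cycleFactor_anticomm (S : IsSpin π ρ) {a c : G} (ha : (π a).sign = 1)
    (hc : π c ∈ (π a).cycleFactorsFinset) (hcs : (π c).sign = -1) :
    ρ c * ρ a = -(ρ a * ρ c) := by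
  have hd : (π (a * c⁻¹)).Disjoint (π c) := by
    rw [map_mul, map_inv]; exact Perm.disjoint_mul_inv_of_mem_cycleFactorsFinset hc
  have h1 := S.anticomm hd (by rw [map_mul, map_inv, Perm.sign_mul, ha, Perm.sign_inv, hcs]; rfl)
    hcs
  have h2 : ρ a = ρ (a * c⁻¹) * ρ c := by rw [← map_mul, inv_mul_cancel_right]
  rw [h2, ← mul_assoc, eq_neg_iff_add_eq_zero, ← add_mul, h1, add_neg_cancel, zero_mul]

theorem pow_orderOf (S : IsSpin π ρ) (a : G) :
    ρ a ^ orderOf (π a) = 1 ∨ ρ a ^ orderOf (π a) = -1 := by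
  rw [← map_pow]
  exact S.ker _ (by rw [map_pow, pow_orderOf_eq_one])

theorem exists_odd_lift (S : IsSpin π ρ) {τ : Perm α} {p : ℕ} (hp : Odd p) (hτ : τ ^ p = 1) :
    ∃ d, π d = τ ∧ ρ d ^ p = 1 := by
  obtain ⟨a, rfl⟩ := S.surj τ
  refine ⟨a ^ (p + 1), by rw [map_pow, pow_succ, hτ, one_mul], ?_⟩
  obtain ⟨m, rfl⟩ := hp
  have h : ρ a ^ (2 * m + 1) = 1 ∨ ρ a ^ (2 * m + 1) = -1 := by
    rw [← map_pow]; exact S.ker _ (by rw [map_pow, hτ])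
  rw [map_pow, ← pow_mul, mul_comm, pow_mul, show 2 * m + 1 + 1 = 2 * (m + 1) by ring, pow_mul]
  rcases h with h | h <;> simp [h]

theorem odd_lift_unique (S : IsSpin π ρ) {a b : G} {p : ℕ} (hp : Odd p) (hab : π a = π b)
    (ha : ρ a ^ p = 1) (hb : ρ b ^ p = 1) : ρ a = ρ b := by
  rcases S.lift_eq hab with h | h
  · exact h
  · rw [h, hp.neg_pow, hb] at ha
    have h0 : (2 : ℂ) • (1 : Module.End ℂ V) = 0 := by
      rw [two_smul]; nth_rewrite 1 [← ha]; exact neg_add_cancel 1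
    have h1 : (1 : Module.End ℂ V) = 0 := (smul_eq_zero.1 h0).resolve_left two_ne_zero
    rw [← mul_one (ρ a), ← mul_one (ρ b), h1, mul_zero, mul_zero]

theorem conj_pow_eq_one {a d : G} {p : ℕ} (hd : ρ d ^ p = 1) : ρ (a * d * a⁻¹) ^ p = 1 := by
  rw [← map_pow, conj_pow, map_mul, map_mul, map_pow, hd, mul_one, ← map_mul, mul_inv_cancel,
    map_one]

theorem odd_lift_comm (S : IsSpin π ρ) {a b : G} {p : ℕ} (hp : Odd p) (ha : ρ a ^ p = 1)
    (hab : Commute (π b) (π a)) : ρ b * ρ a = ρ a * ρ b := by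
  have := S.odd_lift_unique (a := b * a * b⁻¹) (b := a) hp (by
    rw [map_mul, map_mul, map_inv, hab.eq, mul_inv_cancel_right]) (conj_pow_eq_one ha) ha
  nth_rewrite 2 [← this]
  rw [← map_mul, ← map_mul, inv_mul_cancel_right]

end IsSpin

/-! ### Linear algebra -/

namespace Module.End

variable {V : Type*} [AddCommGroup V] [Module ℂ V]

theorem exists_eigenvector_mem [FiniteDimensional ℂ V] {T : Module.End ℂ V} {W : Submodule ℂ V}
    (hW : W ≠ ⊥) (hT : ∀ v ∈ W, T v ∈ W) : ∃ v ∈ W, v ≠ 0 ∧ ∃ μ : ℂ, T v = μ • v := by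
  have : Nontrivial W := (Submodule.nontrivial_iff_ne_bot).2 hW
  obtain ⟨μ, hμ⟩ := Module.End.exists_eigenvalue (T.restrict hT)
  obtain ⟨v, hv⟩ := hμ.exists_hasEigenvector
  refine ⟨v, v.2, fun h => hv.2 (Subtype.ext h), μ, ?_⟩
  have := congrArg Subtype.val hv.apply_eq_smul
  simpa using this

theorem inf_eigenspace_ne_bot {T : Module.End ℂ V} {W : Submodule ℂ V} {v : V} {μ : ℂ}
    (hv : v ∈ W) (h0 : v ≠ 0) (h : T v = μ • v) : W ⊓ T.eigenspace μ ≠ ⊥ := by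
  intro e
  have : v ∈ W ⊓ T.eigenspace μ := ⟨hv, Module.End.mem_eigenspace_iff.2 h⟩
  rw [e] at this
  exact h0 this

theorem exists_joint_eigenvector [FiniteDimensional ℂ V] (f : ℕ → Module.End ℂ V) (m : ℕ)
    (hf : ∀ i < m, ∀ j < m, f i * f j = f j * f i) {W : Submodule ℂ V} (hW : W ≠ ⊥)
    (h : ∀ i < m, ∀ v ∈ W, f i v ∈ W) :
    ∃ v ∈ W, v ≠ 0 ∧ ∃ θ : ℕ → ℂ, ∀ i < m, f i v = θ i • v := by
  induction m generalizing W with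
  | zero =>
    obtain ⟨v, hv, h0⟩ := Submodule.exists_mem_ne_zero_of_ne_bot hW
    exact ⟨v, hv, h0, 0, by simp⟩
  | succ m ih =>
    obtain ⟨u, hu, hu0, μ, huμ⟩ := exists_eigenvector_mem hW (h m (by omega))
    obtain ⟨v, ⟨hv, hvμ⟩, h0, θ, hθ⟩ := ih (fun i hi j hj => hf i (by omega) j (by omega))
      (inf_eigenspace_ne_bot hu hu0 huμ) (by
        rintro i hi v ⟨hv, hvμ⟩
        refine ⟨h i (by omega) v hv, ?_⟩
        rw [SetLike.mem_coe, mem_eigenspace_iff] at hvμ ⊢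
        rw [← Module.End.mul_apply, hf m (by omega) i (by omega), Module.End.mul_apply, hvμ,
          map_smul])
    refine ⟨v, hv, h0, fun i => if i < m then θ i else μ, fun i hi => ?_⟩
    by_cases him : i < m
    · simp only [him, if_pos, hθ i him]
    · obtain rfl : i = m := by omega
      simp only [him, if_false]
      exact mem_eigenspace_iff.1 hvμ

/-- An operator of finite order that is not the identity on an invariant subspace has an
eigenvalue different from `1` there. -/
theorem exists_eigenvector_ne_one [FiniteDimensional ℂ V] {T : Module.End ℂ V} {p : ℕ}
    (hp : p ≠ 0) (hT : T ^ p = 1) {W : Submodule ℂ V} (hW : ∀ v ∈ W, T v ∈ W) {u : V}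
    (hu : u ∈ W) (hne : T u ≠ u) : ∃ v ∈ W, v ≠ 0 ∧ ∃ μ : ℂ, μ ≠ 1 ∧ T v = μ • v := by
  let K : Module.End ℂ V := ∑ i ∈ Finset.range p, T ^ i
  have hK : K * (T - 1) = 0 := by
    rw [geom_sum_mul, hT, sub_self]
  have hcomm : Commute T K := by
    exact Commute.sum_right _ _ _ fun i _ => (Commute.refl T).pow_right i
  obtain ⟨v, ⟨hv, hvK⟩, h0, μ, hμ⟩ := exists_eigenvector_mem (T := T) (W := W ⊓ LinearMap.ker K)
    (by
      intro e
      have : T u - u ∈ W ⊓ LinearMap.ker K := ⟨W.sub_mem (hW u hu) hu, by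
        have := LinearMap.congr_fun hK u
        exact this⟩
      rw [e] at this
      exact hne (sub_eq_zero.1 this)) (by
      rintro v ⟨hv, hvK⟩
      refine ⟨hW v hv, ?_⟩
      change K (T v) = 0
      rw [← Module.End.mul_apply, ← hcomm.eq, Module.End.mul_apply, (hvK : K v = 0), map_zero])
  refine ⟨v, hv, h0, μ, ?_, hμ⟩
  rintro rfl
  have hpow : ∀ i : ℕ, (T ^ i) v = v := by
    intro i
    induction i with
    | zero => simp
    | succ i ih => rw [pow_succ, Module.End.mul_apply, hμ, one_smul, ih]
  have : K v = (p : ℂ) • v := by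
    simp only [K, LinearMap.sum_apply, hpow, Finset.sum_const, Finset.card_range]
    rw [Nat.cast_smul_eq_nsmul]
  rw [(hvK : K v = 0)] at this
  rcases smul_eq_zero.1 this.symm with h | h
  · exact hp (by exact_mod_cast h)
  · exact h0 h

/-- A combination of joint eigenvectors is nonzero if the weight of one of them is isolated. -/
theorem sum_ne_zero_of_weight (T : ℕ → Module.End ℂ V) (u : ℕ → V) (χ : ℕ → ℕ → ℂ)
    (hχ : ∀ m i, T m (u i) = χ i m • u i) (h0 : u 0 ≠ 0) (r : ℕ) (hr : 0 < r)
    (hne : ∀ i, 0 < i → i < r → ∃ m, χ i m ≠ χ 0 m) (a : ℕ → ℂ) (ha : a 0 ≠ 0) :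
    ∑ i ∈ Finset.range r, a i • u i ≠ 0 := by
  have key : ∀ s : ℕ, s ≤ r → ∃ A : Module.End ℂ V, (∀ i, ∃ μ : ℂ, A (u i) = μ • u i) ∧
      (∀ i, 0 < i → i < s → A (u i) = 0) ∧ A (u 0) ≠ 0 := by
    intro s
    induction s with
    | zero => exact fun _ => ⟨1, fun i => ⟨1, by simp⟩, by simp, by simpa⟩
    | succ s ih =>
      intro hs
      obtain ⟨A, hA1, hA2, hA3⟩ := ih (by omega)
      rcases Nat.eq_zero_or_pos s with rfl | hs0
      · exact ⟨A, hA1, fun i h1 h2 => by omega, hA3⟩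
      obtain ⟨m, hm⟩ := hne s hs0 (by omega)
      have hB : ∀ i, (A * (T m - χ s m • 1)) (u i) = (χ i m - χ s m) • A (u i) := by
        intro i
        simp [hχ, sub_smul]
      refine ⟨A * (T m - χ s m • 1), ?_, ?_, ?_⟩
      · intro i
        obtain ⟨μ, hμ⟩ := hA1 i
        exact ⟨(χ i m - χ s m) * μ, by rw [hB, hμ, smul_smul]⟩
      · intro i h1 h2
        rw [hB]
        rcases Nat.lt_or_ge i s with h | h
        · rw [hA2 i h1 h, smul_zero]
        · obtain rfl : i = s := by omega
          rw [sub_self, zero_smul]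
      · rw [hB]
        exact smul_ne_zero (sub_ne_zero.2 (Ne.symm hm)) hA3
  obtain ⟨A, -, hA2, hA3⟩ := key r le_rfl
  intro h
  have h1 := congrArg A h
  rw [map_zero, map_sum, Finset.sum_eq_single 0] at h1
  · rw [map_smul] at h1
    exact smul_ne_zero ha hA3 h1
  · intro i hi hi0
    rw [map_smul, hA2 i (by omega) (Finset.mem_range.1 hi), smul_zero]
  · intro h; exact absurd (Finset.mem_range.2 hr) h

/-- If the weights of `v` form a pattern that is not invariant under nontrivial shifts, every
`r`-th root of the eigenvalue of `c ^ r` is an eigenvalue of `c`. -/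
theorem exists_eigenvector_of_shift {c : Module.End ℂ V} {d : ℕ → Module.End ℂ V} {r : ℕ}
    (hr : 0 < r) (hd : ∀ j, c * d j = d (j + 1) * c) (hper : ∀ j, d (j + r) = d j)
    {W : Submodule ℂ V} (hW : ∀ v ∈ W, c v ∈ W) {v : V} (hv : v ∈ W) (h0 : v ≠ 0) {θ : ℕ → ℂ}
    (hθ : ∀ j, d j v = θ j • v) (hfree : ∀ s, 0 < s → s < r → ∃ j, θ j ≠ θ (j + s)) {η : ℂ}
    (hη : η ≠ 0) (hc : (c ^ r) v = η ^ r • v) : ∃ w ∈ W, w ≠ 0 ∧ c w = η • w := by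
  have hθper : ∀ j, θ (j + r) = θ j := by
    intro j
    have := hθ (j + r)
    rw [hper, hθ] at this
    exact (smul_left_injective ℂ h0 this).symm
  have hper' : ∀ i j, d (j + i * r) = d j := by
    intro i j
    induction i with
    | zero => simp
    | succ i ih => rw [add_mul, one_mul, ← add_assoc, hper, ih]
  have hθper' : ∀ i j, θ (j + i * r) = θ j := by
    intro i j
    induction i with
    | zero => simp
    | succ i ih => rw [add_mul, one_mul, ← add_assoc, hθper, ih]
  have hcd : ∀ i j, c ^ i * d j = d (j + i) * c ^ i := by
    intro i
    induction i with
    | zero => simp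
    | succ i ih => intro j; rw [pow_succ, mul_assoc, hd, ← mul_assoc, ih, mul_assoc]; congr 2; ring
  have hmem : ∀ i, (c ^ i) v ∈ W := by
    intro i
    induction i with
    | zero => simpa
    | succ i ih => rw [pow_succ', Module.End.mul_apply]; exact hW _ ih
  obtain ⟨t, rfl⟩ : ∃ t, r = t + 1 := ⟨r - 1, by omega⟩
  have hχ : ∀ m i, d m ((c ^ i) v) = θ (m + t * i) • (c ^ i) v := by
    intro m i
    have h1 : d m = d (m + t * i + i) := by
      rw [← hper' i m]; congr 1; ring
    rw [h1, ← Module.End.mul_apply, ← hcd, Module.End.mul_apply, hθ, map_smul]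
  refine ⟨∑ i ∈ Finset.range (t + 1), (η⁻¹ ^ i) • (c ^ i) v, ?_, ?_, ?_⟩
  · exact W.sum_mem fun i _ => W.smul_mem _ (hmem i)
  · refine sum_ne_zero_of_weight d (fun i => (c ^ i) v) (fun i m => θ (m + t * i)) hχ (by simpa)
      _ hr ?_ (fun i => η⁻¹ ^ i) (by simp)
    intro i h1 h2
    obtain ⟨j, hj⟩ := hfree i h1 h2
    refine ⟨j + i, fun h => hj ?_⟩
    simp only [mul_zero, add_zero] at h
    rw [← h, ← hθper' i j]
    congr 1; ring
  · rw [map_sum, Finset.smul_sum]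
    have h1 : ∀ i, c (η⁻¹ ^ i • (c ^ i) v) = η • (η⁻¹ ^ (i + 1) • (c ^ (i + 1)) v) := by
      intro i
      rw [map_smul, smul_smul, pow_succ η⁻¹, mul_comm (η⁻¹ ^ i), ← mul_assoc, mul_inv_cancel₀ hη,
        one_mul, pow_succ' c, Module.End.mul_apply]
    simp only [h1]
    rw [Finset.sum_range_succ, Finset.sum_range_succ' (fun i => η • η⁻¹ ^ i • (c ^ i) v), hc,
      smul_smul (η⁻¹ ^ (t + 1)), ← mul_pow, inv_mul_cancel₀ hη]
    simp

end Module.End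

namespace IsSpin

variable {G α V : Type*} [Group G] [Fintype α] [DecidableEq α] [AddCommGroup V] [Module ℂ V]
  {π : G →* Perm α} {ρ : G →* Module.End ℂ V}

theorem support_swap_subset {x y : α} {D : Finset α} (hx : x ∈ D) (hy : y ∈ D) :
    (swap x y).support ⊆ D := by
  intro t ht
  by_contra htD
  rw [Perm.mem_support] at ht
  exact ht (swap_apply_of_ne_of_ne (by rintro rfl; exact htD hx) (by rintro rfl; exact htD hy))

theorem support_mul_subset {σ τ : Perm α} {D : Finset α} (h1 : σ.support ⊆ D)
    (h2 : τ.support ⊆ D) : (σ * τ).support ⊆ D :=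
  (Perm.support_mul_le σ τ).trans (sup_le h1 h2)

theorem neg_eq_self {v : V} (h : -v = v) : v = 0 := by
  have : (2 : ℂ) • v = 0 := by rw [two_smul]; nth_rewrite 1 [← h]; exact neg_add_cancel v
  exact (smul_eq_zero.1 this).resolve_left two_ne_zero

theorem three_cycle_nontrivial (S : IsSpin π ρ) {W : Submodule ℂ V} (hW0 : W ≠ ⊥) {D : Finset α}
    (hW : EInv π ρ W D) {x y w u : α} (hx : x ∈ D) (hy : y ∈ D) (hw : w ∈ D) (hu : u ∈ D)
    (hxy : x ≠ y) (hxw : x ≠ w) (hyw : y ≠ w) (hux : u ≠ x) (huy : u ≠ y) (huw : u ≠ w) {e : G}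
    (he : π e = swap x y * swap y w) : ∃ v ∈ W, ρ e v ≠ v := by
  by_contra! hcon
  obtain ⟨v, hv, h0⟩ := Submodule.exists_mem_ne_zero_of_ne_bot hW0
  obtain ⟨b, hb⟩ := S.surj (swap x y * swap w u)
  have hcon' : ∀ v ∈ W, ρ e⁻¹ v = v := fun v hv => by
    nth_rewrite 1 [← hcon v hv]; exact rho_inv_apply e v
  have hbW : ∀ v ∈ W, ρ b v ∈ W := hW b (by
    rw [hb]; exact support_mul_subset (support_swap_subset hx hy) (support_swap_subset hw hu))
    (by rw [hb, Perm.sign_mul, Perm.sign_swap hxy, Perm.sign_swap huw.symm]; rfl)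
  have hd : ∀ {x y u w : α}, x ≠ u → x ≠ w → y ≠ u → y ≠ w → x ≠ y → u ≠ w →
      (swap x y).Disjoint (swap u w) := by
    intro x y u w h1 h2 h3 h4 h5 h6
    rw [Perm.disjoint_iff_disjoint_support, Perm.support_swap h5, Perm.support_swap h6]
    simp [h1.symm, h2.symm, h3.symm, h4.symm]
  have hbb : ρ b * ρ b = -1 :=
    S.double_sq hxy huw.symm (hd hxw hux.symm hyw huy.symm hxy huw.symm) hb
  have hconj : π (b * (e * b * e⁻¹)) = swap x w * swap y u := by
    have h1 : π (e * b * e⁻¹) = swap y w * swap x u := by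
      rw [map_mul, map_mul, map_inv, hb,
        show π e * (swap x y * swap w u) * (π e)⁻¹ =
          (π e * swap x y * (π e)⁻¹) * (π e * swap w u * (π e)⁻¹) by group,
        ← swap_apply_apply, ← swap_apply_apply, he]
      simp [swap_apply_def, *, hxw.symm, hyw.symm]
    rw [map_mul, h1, hb, Perm.swap_mul_swap_mul_swap_mul_swap hxy hxw hyw hux huy huw]
  have hsq := S.double_sq hxw huy.symm (hd hxy hux.symm hyw.symm huw.symm hxw huy.symm) hconj
  have hE : ∀ v ∈ W, ρ (b * (e * b * e⁻¹)) v = ρ b (ρ b v) := by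
    intro v hv
    rw [rho_mul_apply, rho_mul_apply, rho_mul_apply, hcon' v hv, hcon _ (hbW v hv)]
  have hbb' : ∀ v, ρ b (ρ b v) = -v := fun v => LinearMap.congr_fun hbb v
  have := LinearMap.congr_fun hsq v
  rw [Module.End.mul_apply, hE v hv, hbb', map_neg, hE v hv, hbb'] at this
  simp only [LinearMap.neg_apply, Module.End.one_apply, neg_neg] at this
  exact h0 (neg_eq_self this.symm)

theorem nontrivial_of_commutator (S : IsSpin π ρ) {W : Submodule ℂ V} (hW0 : W ≠ ⊥)
    {D : Finset α} (hW : EInv π ρ W D) {x y w u : α} (hx : x ∈ D) (hy : y ∈ D) (hw : w ∈ D)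
    (hu : u ∈ D) (hxy : x ≠ y) (hxw : x ≠ w) (hyw : y ≠ w) (hux : u ≠ x) (huy : u ≠ y)
    (huw : u ≠ w) {a d : G} (haW : ∀ v ∈ W, ρ a⁻¹ v ∈ W)
    (he : π (a * d * a⁻¹ * d⁻¹) = swap x y * swap y w) : ∃ v ∈ W, ρ d v ≠ v := by
  by_contra! hcon
  obtain ⟨v, hv, h⟩ := S.three_cycle_nontrivial hW0 hW hx hy hw hu hxy hxw hyw hux huy huw he
  apply h
  have h1 : ρ d⁻¹ v = v := by nth_rewrite 1 [← hcon v hv]; exact rho_inv_apply d v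
  rw [rho_mul_apply, h1, rho_mul_apply, rho_mul_apply, hcon _ (haW v hv), rho_apply_inv]

theorem cycle_nontrivial (S : IsSpin π ρ) {W : Submodule ℂ V} (hW0 : W ≠ ⊥) {D : Finset α}
    (hW : Inv π ρ W D) {d : G} (hd : (π d).IsCycle) (hdD : (π d).support ⊆ D)
    (h3 : 3 ≤ (π d).support.card) (h4 : 4 ≤ D.card) : ∃ v ∈ W, ρ d v ≠ v := by
  obtain ⟨x, hx, -⟩ := id hd
  have hxs : x ∈ (π d).support := Perm.mem_support.2 hx
  have hys := Perm.apply_mem_support.2 hxs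
  have hws := Perm.apply_mem_support.2 hys
  have hwx : π d (π d x) ≠ x := by
    intro h
    have h2 : (π d) ^ 2 = 1 := by
      refine (hd.pow_eq_one_iff).2 ⟨x, hx, ?_⟩
      rw [pow_two, Perm.mul_apply, h]
    have := orderOf_dvd_of_pow_eq_one h2
    rw [hd.orderOf] at this
    exact absurd (Nat.le_of_dvd two_pos this) (by omega)
  have hwy : π d (π d x) ≠ π d x := fun h => hx ((π d).injective h)
  obtain ⟨u, hu, hu'⟩ : ∃ u ∈ D, u ∉ ({x, π d x, π d (π d x)} : Finset α) := by
    by_contra! hcon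
    have := Finset.card_le_card (s := D) (t := {x, π d x, π d (π d x)}) hcon
    have := Finset.card_le_three (a := x) (b := π d x) (c := π d (π d x))
    omega
  simp only [Finset.mem_insert, Finset.mem_singleton, not_or] at hu'
  obtain ⟨a, ha⟩ := S.surj (swap x (π d x))
  refine S.nontrivial_of_commutator hW0 hW.eInv (hdD hxs) (hdD hys) (hdD hws) hu hx.symm hwx.symm
    hwy.symm hu'.1 hu'.2.1 hu'.2.2 (a := a) (hW a⁻¹ ?_) ?_
  · rw [map_inv, Perm.support_inv, ha]
    exact support_swap_subset (hdD hxs) (hdD hys)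
  · rw [map_mul, map_mul, map_mul, map_inv, map_inv, ha, swap_inv, mul_assoc, mul_assoc,
      ← mul_assoc (π d), ← swap_apply_apply]

/-- Successively splitting off eigenspaces with eigenvalue `≠ 1`. -/
theorem exists_chain [FiniteDimensional ℂ V] (S : IsSpin π ρ) {d : ℕ → G} {p : ℕ} (hp : p ≠ 0)
    (hd : ∀ j, ρ (d j) ^ p = 1) (hs : ∀ j, (π (d j)).sign = 1) {W : Submodule ℂ V}
    (hW0 : W ≠ ⊥) {D : Finset α} (hW : Inv π ρ W D) (m : ℕ)
    (hD : ∀ j < m, (π (d j)).support ⊆ D)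
    (hdis : ∀ i j, i < j → j < m → Disjoint (π (d i)).support (π (d j)).support)
    (hne : ∀ j < m, ∀ W : Submodule ℂ V, W ≠ ⊥ →
      Inv π ρ W (D \ (Finset.range j).biUnion fun i => (π (d i)).support) →
      ∃ v ∈ W, ρ (d j) v ≠ v) :
    ∃ W' ≤ W, W' ≠ ⊥ ∧ ∃ θ : ℕ → ℂ, ∀ j < m, θ j ≠ 1 ∧ ∀ v ∈ W', ρ (d j) v = θ j • v := by
  suffices h : ∃ W' ≤ W, W' ≠ ⊥ ∧
      Inv π ρ W' (D \ (Finset.range m).biUnion fun i => (π (d i)).support) ∧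
      ∃ θ : ℕ → ℂ, ∀ j < m, θ j ≠ 1 ∧ ∀ v ∈ W', ρ (d j) v = θ j • v by
    obtain ⟨W', h1, h2, -, h3⟩ := h
    exact ⟨W', h1, h2, h3⟩
  induction m with
  | zero => exact ⟨W, le_rfl, hW0, by simpa using hW, 0, by simp⟩
  | succ m ih =>
    obtain ⟨W', hle, hne', hinv, θ, hθ⟩ := ih (fun j hj => hD j (by omega))
      (fun i j hi hj => hdis i j hi (by omega)) (fun j hj => hne j (by omega))
    obtain ⟨u, hu, huv⟩ := hne m (by omega) W' hne' hinv
    have hsub : (π (d m)).support ⊆ D \ (Finset.range m).biUnion fun i => (π (d i)).support := by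
      intro x hx
      rw [Finset.mem_sdiff, Finset.mem_biUnion]
      refine ⟨hD m (by omega) hx, ?_⟩
      rintro ⟨i, hi, hxi⟩
      exact Finset.disjoint_left.1 (hdis i m (Finset.mem_range.1 hi) (by omega)) hxi hx
    obtain ⟨v, hv, hv0, μ, hμ, hvμ⟩ := Module.End.exists_eigenvector_ne_one hp (hd m)
      (hinv (d m) hsub) hu huv
    refine ⟨W' ⊓ (ρ (d m)).eigenspace μ, inf_le_left.trans hle,
      Module.End.inf_eigenspace_ne_bot hv hv0 hvμ, ?_, fun i => if i < m then θ i else μ, ?_⟩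
    · refine S.inv_inf_eigenspace (hs m) hinv ?_ ?_ μ
      · exact Finset.sdiff_subset_sdiff le_rfl (Finset.biUnion_subset_biUnion_of_subset_left _
          (Finset.range_subset_range.2 (Nat.le_succ m)))
      · refine Finset.disjoint_left.2 fun x hx hx' => (Finset.mem_sdiff.1 hx').2 ?_
        exact Finset.mem_biUnion.2 ⟨m, by simp, hx⟩
    · intro j hj
      by_cases hjm : j < m
      · simp only [hjm, if_pos]
        exact ⟨(hθ j hjm).1, fun v hv => (hθ j hjm).2 v hv.1⟩
      · obtain rfl : j = m := by omega
        simp only [hjm, if_false]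
        exact ⟨hμ, fun v hv => Module.End.mem_eigenspace_iff.1 hv.2⟩

end IsSpin

/-- Replacing the entries of a pattern one at a time. -/
theorem pattern_induction {P : (ℕ → ℂ) → ℂ → Prop} {R : ℂ → ℂ → Prop} {r : ℕ}
    (hcongr : ∀ θ θ' ξ, (∀ j < r, θ j = θ' j) → P θ ξ → P θ' ξ)
    (hflip : ∀ θ ξ i x, i < r → P θ ξ → R (θ i) x → P (Function.update θ i x) (ξ * (x / θ i)))
    {θ φ : ℕ → ℂ} {ξ : ℂ} (h : P θ ξ) (hθ : ∀ j < r, θ j ≠ 0)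
    (hφ : ∀ j < r, φ j = θ j ∨ R (θ j) (φ j)) :
    P φ (ξ * ∏ j ∈ Finset.range r, (φ j / θ j)) := by
  have key : ∀ m ≤ r, P (fun j => if j < m then φ j else θ j)
      (ξ * ∏ j ∈ Finset.range m, (φ j / θ j)) := by
    intro m
    induction m with
    | zero => intro _; simpa using h
    | succ m ih =>
      intro hm
      rw [Finset.prod_range_succ, ← mul_assoc]
      rcases hφ m (by omega) with h1 | h1
      · rw [h1, div_self (hθ m (by omega)), mul_one]
        refine hcongr _ _ _ (fun j hj => ?_) (ih (by omega))
        rcases lt_trichotomy j m with h2 | h2 | h2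
        · simp [h2, h2.trans (Nat.lt_succ_self m)]
        · subst h2; simp [h1]
        · simp [h2.not_gt, show ¬ j < m + 1 by omega]
      · have := hflip _ _ m (φ m) (by omega) (ih (by omega)) (by simpa using h1)
        simp only [lt_irrefl, if_false] at this
        refine hcongr _ _ _ (fun j hj => ?_) this
        rcases lt_trichotomy j m with h2 | h2 | h2
        · simp [h2.ne, h2, h2.trans (Nat.lt_succ_self m)]
        · subst h2; simp
        · simp [h2.ne', h2.not_gt, show ¬ j < m + 1 by omega]
  exact hcongr _ _ _ (fun j hj => by simp [hj]) (key r le_rfl)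

theorem exists_roots_of_lcm {a b : ℕ} (ha : 0 < a) {x : ℂ} (hx : x ^ a.lcm b = 1) :
    ∃ u v : ℂ, u ^ a = 1 ∧ v ^ b = 1 ∧ x = u * v := by
  have hx0 : x ≠ 0 ∨ a.lcm b = 0 := by
    by_contra! h
    rw [h.1, zero_pow h.2] at hx
    exact zero_ne_one hx
  rcases Nat.eq_zero_or_pos b with rfl | hb
  · exact ⟨1, x, one_pow _, pow_zero _, (one_mul _).symm⟩
  have hx0 : x ≠ 0 := hx0.resolve_right (Nat.lcm_ne_zero ha.ne' hb.ne')
  obtain ⟨a', b', hab, ha', hb'⟩ := Nat.exists_coprime a b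
  set g := a.gcd b
  have hl : a.lcm b = a * b' := by
    have h1 := Nat.gcd_mul_lcm a b
    have hg : 0 < a.gcd b := Nat.gcd_pos_of_pos_left _ ha
    refine Nat.eq_of_mul_eq_mul_left hg ?_
    rw [h1]
    calc a * b = a * (b' * g) := by rw [← hb']
      _ = g * (a * b') := by ring
  have hl' : a.lcm b = b * a' := by
    rw [hl]
    calc a * b' = a' * g * b' := by rw [← ha']
      _ = b' * g * a' := by ring
      _ = b * a' := by rw [← hb']
  obtain ⟨r, s, hrs⟩ : ∃ r s : ℤ, r * a' + s * b' = 1 :=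
    Int.isCoprime_iff_gcd_eq_one.2 (by simpa using hab)
  refine ⟨x ^ (s * b'), x ^ (r * a'), ?_, ?_, ?_⟩
  · rw [← zpow_natCast, ← zpow_mul, show s * b' * (a : ℤ) = (a.lcm b : ℕ) * s by
      rw [hl]; push_cast; ring, zpow_mul, zpow_natCast, hx, one_zpow]
  · rw [← zpow_natCast, ← zpow_mul, show r * a' * (b : ℤ) = (a.lcm b : ℕ) * r by
      rw [hl']; push_cast; ring, zpow_mul, zpow_natCast, hx, one_zpow]
  · rw [← zpow_add₀ hx0, add_comm, hrs, zpow_one]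

theorem exists_pow_root {n : ℕ} (hn : 0 < n) (x : ℂ) : ∃ y : ℂ, y ^ n = x :=
  IsAlgClosed.exists_pow_nat_eq x hn

namespace IsSpin

variable {G α V : Type*} [Group G] [Fintype α] [DecidableEq α] [AddCommGroup V] [Module ℂ V]
  {π : G →* Perm α} {ρ : G →* Module.End ℂ V}

/-- Every `orderOf (π y)`-th root of the scalar `ρ y ^ orderOf (π y)` is an eigenvalue of `ρ y` on
each nonzero subspace preserved by the elements acting inside `D`. -/
def Full (π : G →* Perm α) (ρ : G →* Module.End ℂ V) (y : G) (D : Finset α) : Prop :=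
  ∀ W : Submodule ℂ V, W ≠ ⊥ → Inv π ρ W D → ∀ ν : ℂ,
    ρ y ^ orderOf (π y) = ν ^ orderOf (π y) • (1 : Module.End ℂ V) → ∃ w ∈ W, w ≠ 0 ∧ ρ y w = ν • w

/-- The analogue of `Full` for subspaces preserved by even elements only. -/
def EFull (π : G →* Perm α) (ρ : G →* Module.End ℂ V) (y : G) (D : Finset α) : Prop :=
  ∀ W : Submodule ℂ V, W ≠ ⊥ → EInv π ρ W D → ∀ ν : ℂ,
    ρ y ^ orderOf (π y) = ν ^ orderOf (π y) • (1 : Module.End ℂ V) → ∃ w ∈ W, w ≠ 0 ∧ ρ y w = ν • w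

theorem Full.mono {y : G} {D E : Finset α} (h : Full π ρ y D) (hD : D ⊆ E) : Full π ρ y E :=
  fun W hW0 hW => h W hW0 (hW.mono hD)

theorem Full.congr (S : IsSpin π ρ) {y y' : G} {D : Finset α} (h : Full π ρ y D)
    (hy : π y = π y') : Full π ρ y' D := by
  intro W hW0 hW ν hν
  rcases S.lift_eq hy with e | e
  · rw [← e, ← hy] at hν
    rw [← e]
    exact h W hW0 hW ν hν
  · have e' : ρ y' = -ρ y := by rw [e, neg_neg]
    obtain ⟨w, hw, hw0, hwν⟩ := h W hW0 hW (-ν) (by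
      rw [e, hy]
      rcases Nat.even_or_odd (orderOf (π y')) with ho | ho
      · rw [ho.neg_pow, ho.neg_pow, hν]
      · rw [ho.neg_pow, ho.neg_pow, hν, neg_smul])
    exact ⟨w, hw, hw0, by rw [e', LinearMap.neg_apply, hwν, neg_smul, neg_neg]⟩

theorem exists_root (S : IsSpin π ρ) (y : G) :
    ∃ ν : ℂ, ρ y ^ orderOf (π y) = ν ^ orderOf (π y) • (1 : Module.End ℂ V) := by
  have hpos : 0 < orderOf (π y) := orderOf_pos _
  rcases S.pow_orderOf y with h | h
  · exact ⟨1, by rw [h, one_pow, one_smul]⟩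
  · obtain ⟨ν, hν⟩ := exists_pow_root hpos (-1)
    exact ⟨ν, by rw [h, hν, neg_one_smul]⟩

theorem root_ne_zero [Nontrivial V] {y : G} {n : ℕ} {ν : ℂ}
    (h : ρ y ^ n = ν ^ n • (1 : Module.End ℂ V)) (hn : n ≠ 0) : ν ≠ 0 := by
  rintro rfl
  obtain ⟨v, hv⟩ := exists_ne (0 : V)
  have h1 : ρ (y ^ n) v = 0 := by rw [map_pow, h, zero_pow hn, zero_smul]; rfl
  exact rho_ne_zero _ hv h1

theorem Full.mul (S : IsSpin π ρ) {y₁ y₂ : G} {D₁ D₂ : Finset α} (h₁ : Full π ρ y₁ D₁)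
    (h₂ : Full π ρ y₂ D₂) (hdis : (π y₁).Disjoint (π y₂)) (hs : (π y₁).sign = 1)
    (hD : Disjoint (π y₁).support D₂) : Full π ρ (y₁ * y₂) (D₁ ∪ D₂) := by
  intro W hW0 hW ν hν
  have : Nontrivial V := by
    obtain ⟨v, -, h0⟩ := Submodule.exists_mem_ne_zero_of_ne_bot hW0
    exact ⟨v, 0, h0⟩
  have hcomm : Commute (ρ y₁) (ρ y₂) := S.comm_of_sign_left hdis hs
  obtain ⟨ν₁, hν₁⟩ := S.exists_root y₁
  obtain ⟨ν₂, hν₂⟩ := S.exists_root y₂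
  have ha : 0 < orderOf (π y₁) := orderOf_pos _
  have hb : 0 < orderOf (π y₂) := orderOf_pos _
  have h10 := root_ne_zero hν₁ ha.ne'
  have h20 := root_ne_zero hν₂ hb.ne'
  rw [map_mul, map_mul, hdis.orderOf, hcomm.mul_pow] at hν
  have hpow : ∀ {y : G} {ν : ℂ} {n m : ℕ}, ρ y ^ n = ν ^ n • (1 : Module.End ℂ V) → n ∣ m →
      ρ y ^ m = ν ^ m • (1 : Module.End ℂ V) := by
    rintro y ν n m h ⟨k, rfl⟩
    rw [pow_mul, h, smul_pow, one_pow, pow_mul]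
  rw [hpow hν₁ (Nat.dvd_lcm_left _ _), hpow hν₂ (Nat.dvd_lcm_right _ _), smul_mul_smul_comm,
    one_mul] at hν
  have hν' := smul_left_injective ℂ (one_ne_zero (α := Module.End ℂ V)) hν
  obtain ⟨u, v, hu, hv, huv⟩ := exists_roots_of_lcm (a := orderOf (π y₁)) (b := orderOf (π y₂))
    ha (x := ν / (ν₁ * ν₂)) (by
      rw [div_pow, mul_pow, ← hν']
      exact div_self (mul_ne_zero (pow_ne_zero _ h10) (pow_ne_zero _ h20)))
  obtain ⟨w, hw, hw0, hwν⟩ := h₁ W hW0 (hW.mono Finset.subset_union_left) (ν₁ * u) (by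
    rw [mul_pow, hu, mul_one, hν₁])
  obtain ⟨w', hw', hw0', hwν'⟩ := h₂ (W ⊓ (ρ y₁).eigenspace (ν₁ * u))
    (Module.End.inf_eigenspace_ne_bot hw hw0 hwν)
    (S.inv_inf_eigenspace hs hW Finset.subset_union_right hD _) (ν₂ * v) (by
    rw [mul_pow, hv, mul_one, hν₂])
  refine ⟨w', hw'.1, hw0', ?_⟩
  rw [rho_mul_apply, hwν', map_smul, Module.End.mem_eigenspace_iff.1 hw'.2, smul_smul]
  congr 1
  have : ν = u * v * (ν₁ * ν₂) := by rw [← huv, div_mul_cancel₀ _ (mul_ne_zero h10 h20)]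
  rw [this]; ring

/-- Two opposite eigenvalues. -/
theorem eigen_or_neg {T : Module.End ℂ V} {W : Submodule ℂ V} (hT : ∀ v ∈ W, T v ∈ W) {v : V}
    (hv : v ∈ W) (h0 : v ≠ 0) {ν : ℂ} (h : T (T v) = ν ^ 2 • v) :
    (∃ w ∈ W, w ≠ 0 ∧ T w = ν • w) ∨ ∃ w ∈ W, w ≠ 0 ∧ T w = (-ν) • w := by
  by_cases hu : T v - ν • v = 0
  · exact Or.inl ⟨v, hv, h0, sub_eq_zero.1 hu⟩
  · refine Or.inr ⟨T v - ν • v, W.sub_mem (hT v hv) (W.smul_mem _ hv), hu, ?_⟩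
    rw [map_sub, h, map_smul, smul_sub, smul_smul]
    rw [neg_smul, pow_two, neg_mul, neg_smul]
    abel

theorem sign_of_isCycle {τ : Perm α} (hτ : τ.IsCycle) (h : Even τ.support.card) : τ.sign = -1 := by
  rw [hτ.sign, h.neg_one_pow]

theorem sign_of_isCycle_odd {τ : Perm α} (hτ : τ.IsCycle) (h : Odd τ.support.card) :
    τ.sign = 1 := by
  rw [hτ.sign, h.neg_one_pow, neg_neg]

theorem exists_odd_cycleFactor {σ : Perm α} {e : ℕ} (he : orderOf σ = 2 ^ (e + 1)) :
    ∃ τ ∈ σ.cycleFactorsFinset, τ.sign = -1 := by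
  obtain ⟨x, hx⟩ : ∃ x, σ x ≠ x := by
    by_contra! hcon
    rw [show σ = 1 from Perm.ext hcon, orderOf_one] at he
    exact absurd he (by have := Nat.one_lt_two_pow (n := e + 1) (by omega); omega)
  have hcyc : (σ.cycleOf x).IsCycle := Perm.isCycle_cycleOf _ hx
  refine ⟨_, Perm.cycleOf_mem_cycleFactorsFinset_iff.2 (Perm.mem_support.2 hx),
    sign_of_isCycle hcyc ?_⟩
  have h1 := Perm.orderOf_cycleOf_dvd_orderOf σ x
  rw [he, Nat.dvd_prime_pow Nat.prime_two] at h1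
  obtain ⟨k, -, hk⟩ := h1
  rw [hcyc.orderOf] at hk
  have := hcyc.two_le_card_support
  rw [hk] at this ⊢
  rcases k with _ | k
  · simp at this
  · exact ⟨2 ^ k, by ring⟩

theorem full_of_two_pow (S : IsSpin π ρ) (e : ℕ) {a : G} (hs : (π a).sign = 1)
    (he : orderOf (π a) = 2 ^ e) : Full π ρ a (π a).support := by
  induction e generalizing a with
  | zero =>
    intro W hW0 _ ν hν
    obtain ⟨v, hv, h0⟩ := Submodule.exists_mem_ne_zero_of_ne_bot hW0
    rw [he, pow_zero, pow_one, pow_one] at hν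
    exact ⟨v, hv, h0, by rw [hν]; rfl⟩
  | succ e ih =>
    intro W hW0 hW ν hν
    have ho : orderOf (π (a * a)) = 2 ^ e := by
      rw [map_mul, ← pow_two, orderOf_pow_of_dvd two_ne_zero
        (by rw [he]; exact ⟨2 ^ e, pow_succ' 2 e⟩),
        he, pow_succ, Nat.mul_div_cancel _ two_pos]
    have hsub : (π (a * a)).support ⊆ (π a).support := by
      rw [map_mul]; exact support_mul_subset subset_rfl subset_rfl
    obtain ⟨v, hv, h0, hvν⟩ := ih (a := a * a) (by rw [map_mul, map_mul, hs, one_mul]) ho W hW0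
      (hW.mono hsub) (ν ^ 2) (by
        rw [ho, map_mul, ← pow_two, ← pow_mul, ← pow_mul, ← pow_succ', ← he, hν])
    rw [rho_mul_apply] at hvν
    rcases eigen_or_neg (hW a subset_rfl) hv h0 hvν with h | ⟨w, hw, hw0, hwν⟩
    · exact h
    obtain ⟨τ, hmem, hcs⟩ := exists_odd_cycleFactor he
    obtain ⟨c, rfl⟩ := S.surj τ
    have hanti := S.cycleFactor_anticomm hs hmem hcs
    refine ⟨ρ c w, hW c (Perm.mem_cycleFactorsFinset_support_le hmem) w hw, rho_ne_zero c hw0, ?_⟩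
    have := LinearMap.congr_fun hanti w
    rw [Module.End.mul_apply, LinearMap.neg_apply, Module.End.mul_apply, hwν, map_smul,
      neg_smul] at this
    exact (neg_inj.1 this).symm

end IsSpin

namespace Equiv.Perm.IsCycle

variable {α : Type*} [Fintype α] [DecidableEq α]

/-- The cycles of `σ ^ r` for a `(p * r)`-cycle `σ`. -/
theorem exists_conj_family {σ : Perm α} (hσ : σ.IsCycle) {p r : ℕ} (hp : 2 ≤ p) (hr : 0 < r)
    (h : σ.support.card = p * r) : ∃ τ : Perm α, τ.IsCycle ∧ τ.support.card = p ∧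
      Commute (σ ^ r) τ ∧ (∀ j : ℕ, σ ^ j * τ * (σ ^ j)⁻¹ ∈ (σ ^ r).cycleFactorsFinset) ∧
      ∀ i j : ℕ, i < j → j < r →
        _root_.Disjoint (σ ^ i * τ * (σ ^ i)⁻¹).support (σ ^ j * τ * (σ ^ j)⁻¹).support := by
  obtain ⟨x, hx, -⟩ := id hσ
  have hcyc : ∀ a b : ℕ, (σ ^ a) x = (σ ^ b) x → a ≡ b [MOD p * r] := by
    intro a b hab
    have := hσ.pow_eq_pow_iff.2 ⟨x, hx, hab⟩
    rwa [pow_eq_pow_iff_modEq, hσ.orderOf, h] at this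
  have hrx : (σ ^ r) x ≠ x := by
    intro e
    have := hcyc r 0 (by simpa using e)
    rw [Nat.modEq_zero_iff_dvd] at this
    have := Nat.le_of_dvd hr this
    nlinarith
  have hτ := Perm.isCycle_cycleOf (σ ^ r) hrx
  have hτx : (σ ^ r).cycleOf x x ≠ x := by rwa [Perm.cycleOf_apply_self]
  have hmem : (σ ^ r).cycleOf x ∈ (σ ^ r).cycleFactorsFinset :=
    Perm.cycleOf_mem_cycleFactorsFinset_iff.2 (Perm.mem_support.2 hrx)
  have hmem' : ∀ j : ℕ, σ ^ j * (σ ^ r).cycleOf x * (σ ^ j)⁻¹ ∈ (σ ^ r).cycleFactorsFinset := by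
    intro j
    have hc : σ ^ j * σ ^ r * (σ ^ j)⁻¹ = σ ^ r := by
      rw [← pow_add, add_comm, pow_add, mul_inv_cancel_right]
    have := (Perm.mem_cycleFactorsFinset_conj (σ ^ r) (σ ^ j) ((σ ^ r).cycleOf x)).2 hmem
    rwa [hc] at this
  have hconj : ∀ j : ℕ, σ ^ j * (σ ^ r).cycleOf x * (σ ^ j)⁻¹ = (σ ^ r).cycleOf ((σ ^ j) x) := by
    intro j
    refine Perm.cycle_is_cycleOf ?_ (hmem' j)
    rw [Perm.mem_support, Perm.mul_apply, Perm.mul_apply, Perm.inv_def, Equiv.symm_apply_apply]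
    exact fun e => hτx ((σ ^ j).injective e)
  refine ⟨_, hτ, ?_, ?_, hmem', ?_⟩
  · rw [← hτ.orderOf]
    refine Nat.dvd_antisymm ?_ ?_
    · refine orderOf_dvd_of_pow_eq_one (hτ.pow_eq_one_iff.2 ⟨x, hτx, ?_⟩)
      rw [Perm.cycleOf_pow_apply_self, ← pow_mul, mul_comm, ← h, ← hσ.orderOf, pow_orderOf_eq_one,
        Perm.one_apply]
    · have h1 := Perm.cycleOf_pow_apply_self (σ ^ r) x (orderOf ((σ ^ r).cycleOf x))
      rw [pow_orderOf_eq_one, Perm.one_apply, ← pow_mul] at h1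
      have := hcyc (r * orderOf ((σ ^ r).cycleOf x)) 0 (by rw [← h1]; rfl)
      rw [Nat.modEq_zero_iff_dvd, mul_comm p] at this
      exact Nat.dvd_of_mul_dvd_mul_left hr this
  · exact Perm.self_mem_cycle_factors_commute hmem |>.symm
  · intro i j hij hj
    rw [← Perm.disjoint_iff_disjoint_support]
    refine Perm.cycleFactorsFinset_pairwise_disjoint _ (hmem' i) (hmem' j) ?_
    rw [hconj, hconj]
    intro e
    have hs : (σ ^ r).SameCycle ((σ ^ i) x) ((σ ^ j) x) := by
      have h2 := hmem' i
      rw [hconj, Perm.cycleOf_mem_cycleFactorsFinset_iff] at h2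
      have h3 := hmem' j
      rw [hconj, Perm.cycleOf_mem_cycleFactorsFinset_iff] at h3
      have h4 : (σ ^ j) x ∈ ((σ ^ r).cycleOf ((σ ^ i) x)).support := by
        rw [e, Perm.mem_support, Perm.cycleOf_apply_self]
        exact Perm.mem_support.1 h3
      exact (Perm.mem_support_cycleOf_iff.1 h4).1
    obtain ⟨m, -, hm⟩ := hs.exists_pow_eq'
    rw [← pow_mul, ← Perm.mul_apply, ← pow_add] at hm
    have h5 := (hcyc _ _ hm).of_dvd (Dvd.intro_left p rfl)
    have h6 : i ≡ j [MOD r] := by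
      refine Nat.ModEq.trans ?_ h5
      rw [Nat.ModEq, Nat.mul_add_mod]
    rw [Nat.ModEq, Nat.mod_eq_of_lt hj, Nat.mod_eq_of_lt (hij.trans hj)] at h6
    omega

/-- A cycle is conjugate to its coprime powers inside its support. -/
theorem exists_conj_pow {τ : Perm α} (hτ : τ.IsCycle) {u : ℕ} (hu : (orderOf τ).Coprime u) :
    ∃ a : Perm α, a.support ⊆ τ.support ∧ a * τ * a⁻¹ = τ ^ u := by
  have hs : (τ ^ u).support = τ.support := Perm.support_pow_coprime hu.symm
  have hcu : (τ ^ u).IsCycle := (hτ.pow_iff).2 hu.symm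
  obtain ⟨b, hb⟩ := _root_.isConj_iff.1 (hτ.isConj hcu (by rw [hs]))
  have hbs : ∀ x, b x ∈ τ.support ↔ x ∈ τ.support := by
    intro x
    nth_rewrite 1 [← hs]
    rw [← hb, Perm.mem_support, Perm.mem_support]
    simp
  have hin : ∀ x, x ∈ τ.support →
      Perm.ofSubtype (b.subtypePerm (p := fun x => x ∈ τ.support) hbs) x = b x := by
    intro x hx
    rw [Perm.ofSubtype_apply_of_mem _ hx]; rfl
  have hout : ∀ x, x ∉ τ.support →
      Perm.ofSubtype (b.subtypePerm (p := fun x => x ∈ τ.support) hbs) x = x := by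
    intro x hx
    rw [Perm.ofSubtype_apply_of_not_mem _ hx]
  refine ⟨Perm.ofSubtype (b.subtypePerm (p := fun x => x ∈ τ.support) hbs), ?_, ?_⟩
  · intro x hx
    by_contra h
    exact Perm.mem_support.1 hx (hout x h)
  · rw [mul_inv_eq_iff_eq_mul]
    ext x
    by_cases hx : x ∈ τ.support
    · rw [Perm.mul_apply, Perm.mul_apply, hin x hx, hin _ (Perm.apply_mem_support.2 hx), ← hb]
      simp
    · rw [Perm.mul_apply, Perm.mul_apply, hout x hx, Perm.notMem_support.1 hx, hout x hx,
        Perm.notMem_support.1 (by rw [hs]; exact hx)]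

end Equiv.Perm.IsCycle

theorem exists_root_notMem {p : ℕ} [NeZero p] (F : Finset ℂ) (hF : F.card < p) :
    ∃ x : ℂ, x ^ p = 1 ∧ x ∉ F := by
  by_contra! h
  have h1 : Polynomial.nthRootsFinset p (1 : ℂ) ⊆ F := fun x hx =>
    h x ((Polynomial.mem_nthRootsFinset (NeZero.pos p) 1).1 hx)
  have h2 := Finset.card_le_card h1
  rw [(Complex.isPrimitiveRoot_exp p (NeZero.ne p)).card_nthRootsFinset] at h2
  omega

/-- The initial segment of a pattern of length `r` on which `Q` holds shows that the pattern is not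
invariant under a proper cyclic shift. -/
theorem exists_ne_shift {r m : ℕ} {φ : ℕ → ℂ} {Q : ℂ → Prop} (hm : 0 < m) (hmr : m < r)
    (hQ : ∀ j < r, Q (φ j) ↔ j < m) {s : ℕ} (hs : 0 < s) (hsr : s < r) :
    ∃ j, φ (j % r) ≠ φ ((j + s) % r) := by
  by_contra! h
  have h1 := h (r - s)
  rw [Nat.mod_eq_of_lt (by omega), Nat.sub_add_cancel hsr.le, Nat.mod_self] at h1
  have h2 := h (r - 1 - s)
  rw [Nat.mod_eq_of_lt (by omega), Nat.sub_add_cancel (by omega), Nat.mod_eq_of_lt (by omega)] at h2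
  have h3 := (hQ (r - s) (by omega)).1 (by rw [h1]; exact (hQ 0 (by omega)).2 hm)
  have h4 := fun h : r - 1 - s < m =>
    (hQ (r - 1) (by omega)).1 (by rw [← h2]; exact (hQ (r - 1 - s) (by omega)).2 h)
  by_cases h5 : r - 1 - s < m
  · have := h4 h5; omega
  · omega

theorem prod_range_two_add (x y ω : ℂ) (k : ℕ) :
    ∏ j ∈ Finset.range (k + 2), (if j = 0 then x else if j = 1 then y else ω) = ω ^ k * y * x := by
  rw [Finset.prod_range_succ', Finset.prod_range_succ']
  simp

theorem prod_range_ite_lt (ω : ℂ) (r m : ℕ) :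
    ∏ j ∈ Finset.range r, (if j < m then ω ^ 2 else ω) = ω ^ (r + min r m) := by
  induction r with
  | zero => simp
  | succ r ih =>
    rw [Finset.prod_range_succ, ih]
    split_ifs with h
    · rw [← pow_add]; congr 1; omega
    · rw [← pow_succ]; congr 1; omega

/-- Aperiodic patterns of nontrivial `p`-th roots of unity with prescribed product. -/
theorem exists_pattern {p r : ℕ} (hp : p.Prime) (hp2 : 5 ≤ p) (hr : 2 ≤ r) (hr3 : r ≠ 3) {x : ℂ}
    (hx : x ^ p = 1) : ∃ (φ : ℕ → ℂ) (m : ℕ) (Q : ℂ → Prop), (∀ j < r, φ j ^ p = 1 ∧ φ j ≠ 1) ∧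
      ∏ j ∈ Finset.range r, φ j = x ∧ 0 < m ∧ m < r ∧ ∀ j < r, Q (φ j) ↔ j < m := by
  have : NeZero p := ⟨hp.ne_zero⟩
  obtain ⟨k, rfl⟩ := Nat.exists_eq_add_of_le' hr
  obtain ⟨ω, hω, hω'⟩ := exists_root_notMem (p := p) {1} (by rw [Finset.card_singleton]; omega)
  rw [Finset.mem_singleton] at hω'
  have hω0 : ω ≠ 0 := by rintro rfl; rw [zero_pow hp.ne_zero] at hω; exact zero_ne_one hω
  have hx0 : x ≠ 0 := by rintro rfl; rw [zero_pow hp.ne_zero] at hx; exact zero_ne_one hx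
  set x' := x / ω ^ k with hx'
  have hx'p : x' ^ p = 1 := by rw [hx', div_pow, hx, ← pow_mul, mul_comm, pow_mul, hω]; simp
  have hx'0 : x' ≠ 0 := div_ne_zero hx0 (pow_ne_zero _ hω0)
  obtain ⟨u, hu, hu'⟩ := exists_root_notMem (p := p)
    {1, x', if k = 0 then x' ^ ((p + 1) / 2) else ω, if k = 0 then 1 else x' / ω} (by
      have := Finset.card_le_four (a := 1) (b := x')
        (c := if k = 0 then x' ^ ((p + 1) / 2) else ω) (d := if k = 0 then 1 else x' / ω)
      omega)
  simp only [Finset.mem_insert, Finset.mem_singleton, not_or] at hu'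
  obtain ⟨h1, h2, h3, h4⟩ := hu'
  have hu0 : u ≠ 0 := by rintro rfl; rw [zero_pow hp.ne_zero] at hu; exact zero_ne_one hu
  have hv1 : x' / u ≠ 1 := fun e => h2 (by rw [div_eq_one_iff_eq hu0] at e; exact e.symm)
  refine ⟨fun j => if j = 0 then u else if j = 1 then x' / u else ω, if k = 0 then 1 else 2,
    fun z => if k = 0 then z = u else z ≠ ω, ?_, ?_, by split_ifs <;> omega,
    by split_ifs <;> omega, ?_⟩
  · intro j _
    dsimp only
    split_ifs
    · exact ⟨hu, h1⟩
    · exact ⟨by rw [div_pow, hx'p, hu, div_one], hv1⟩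
    · exact ⟨hω, hω'⟩
  · rw [prod_range_two_add, hx']
    field_simp
  · intro j hj
    dsimp only
    by_cases hk : k = 0
    · simp only [hk, if_true] at h3 ⊢
      have hj2 : j = 0 ∨ j = 1 := by omega
      rcases hj2 with rfl | rfl
      · simp
      · simp only [one_ne_zero, if_false, if_true, lt_irrefl, iff_false]
        intro e
        apply h3
        rw [div_eq_iff hu0] at e
        rw [e, ← pow_two, ← pow_mul]
        have : 2 * ((p + 1) / 2) = p + 1 := by
          rcases hp.eq_two_or_odd' with h | ⟨t, ht⟩
          · omega
          · omega
        rw [this, pow_succ, hu, one_mul]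
    · simp only [hk, if_false] at h3 h4 ⊢
      by_cases hj0 : j = 0
      · simp [hj0, h3]
      by_cases hj1 : j = 1
      · simp only [hj1, one_ne_zero, if_false, if_true, ne_eq, one_lt_two, iff_true]
        intro e
        rw [div_eq_iff hu0] at e
        exact h4 (by rw [e]; field_simp)
      · simp only [hj0, hj1, if_false, ne_eq, not_true_eq_false, false_iff]
        omega

theorem exists_cube_root : ∃ ω : ℂ, ω ^ 3 = 1 ∧ ω ≠ 1 ∧
    ∀ z : ℂ, z ^ 3 = 1 → ∃ i : ℕ, 1 ≤ i ∧ i ≤ 3 ∧ z = ω ^ i := by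
  have h := Complex.isPrimitiveRoot_exp 3 (by norm_num)
  refine ⟨_, h.pow_eq_one, h.ne_one (by norm_num), fun z hz => ?_⟩
  obtain ⟨i, hi, rfl⟩ := h.eq_pow_of_pow_eq_one hz
  rcases Nat.eq_zero_or_pos i with rfl | h0
  · exact ⟨3, by norm_num, le_rfl, by rw [h.pow_eq_one, pow_zero]⟩
  · exact ⟨i, h0, hi.le, rfl⟩

/-- Aperiodic patterns of cube roots of unity with prescribed last entry and product. -/
theorem exists_pattern_three {r : ℕ} (hr : 4 ≤ r) {x : ℂ} (hx : x ^ 3 = 1) (t : ℂ) :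
    ∃ (φ : ℕ → ℂ) (m : ℕ) (Q : ℂ → Prop), (∀ j < r, φ j ^ 3 = 1 ∧ (φ j = 1 ↔ j = r - 1 ∧ t = 1)) ∧
      ∏ j ∈ Finset.range r, φ j = x ∧ 0 < m ∧ m < r ∧ ∀ j < r, Q (φ j) ↔ j < m := by
  obtain ⟨ω, hω, hω', hall⟩ := exists_cube_root
  have hω0 : ω ≠ 0 := by rintro rfl; norm_num at hω
  have hω2 : ω ^ 2 ≠ 1 := fun h => hω' (by rw [← hω, pow_succ, h, one_mul])
  have hωω : ω ^ 2 ≠ ω := fun h => hω2 (by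
    have : ω * ω = ω * 1 := by rw [← pow_two, h, mul_one]
    rw [pow_two, mul_left_cancel₀ hω0 this, one_mul])
  have hω23 : (ω ^ 2) ^ 3 = 1 := by rw [← pow_mul, mul_comm, pow_mul, hω, one_pow]
  by_cases ht1 : t = 1
  · obtain ⟨i, hi, hi3, hxi⟩ := hall (x / ω ^ (r - 1)) (by
      rw [div_pow, hx, ← pow_mul, mul_comm, pow_mul, hω]; simp)
    have hx' : x = ω ^ (r - 1 + i) := by
      rw [pow_add, ← hxi]; field_simp
    obtain ⟨k, rfl⟩ := Nat.exists_eq_add_of_le' (show 1 ≤ r by omega)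
    refine ⟨fun j => if j = k then 1 else if j < i % 3 then ω ^ 2 else ω, k, fun z => z ≠ 1, ?_, ?_,
      by omega, by omega, ?_⟩
    · intro j hj
      dsimp only
      split_ifs with h1 h2
      · simp [h1, ht1]
      · simp [hω23, hω2, h1]
      · simp [hω, hω', h1]
    · rw [Finset.prod_range_succ, Finset.prod_congr rfl (g := fun j =>
        if j < i % 3 then ω ^ 2 else ω) (fun j hj => by
          rw [if_neg (Finset.mem_range.1 hj).ne]), prod_range_ite_lt, if_pos rfl, mul_one, hx',
        Nat.add_sub_cancel, Nat.min_eq_right (by omega), pow_add, pow_add]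
      interval_cases i <;> simp [hω]
    · intro j hj
      dsimp only
      split_ifs with h1 h2
      · simp [h1]
      · simp only [ne_eq, hω2, not_false_eq_true, true_iff]; omega
      · simp only [ne_eq, hω', not_false_eq_true, true_iff]; omega
  · obtain ⟨i, hi, hi3, hxi⟩ := hall (x / ω ^ r) (by
      rw [div_pow, hx, ← pow_mul, mul_comm, pow_mul, hω]; simp)
    have hx' : x = ω ^ (r + i) := by
      rw [pow_add, ← hxi]; field_simp
    refine ⟨fun j => if j < i then ω ^ 2 else ω, i, fun z => z ≠ ω, ?_, ?_, by omega, by omega, ?_⟩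
    · intro j hj
      dsimp only
      split_ifs with h1
      · simp [hω23, hω2, ht1]
      · simp [hω, hω', ht1]
    · rw [prod_range_ite_lt, hx', Nat.min_eq_right (by omega)]
    · intro j hj
      dsimp only
      split_ifs with h1
      · simp [hωω, h1]
      · simp [h1]

namespace IsSpin

variable {G α V : Type*} [Group G] [Fintype α] [DecidableEq α] [AddCommGroup V] [Module ℂ V]
  {π : G →* Perm α} {ρ : G →* Module.End ℂ V}

theorem mul_conj_pow (c d : G) (j : ℕ) :
    ρ c * ρ (c ^ j * d * (c ^ j)⁻¹) = ρ (c ^ (j + 1) * d * (c ^ (j + 1))⁻¹) * ρ c := by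
  rw [← map_mul, ← map_mul, pow_succ', mul_inv_rev]
  simp only [mul_assoc, inv_mul_cancel, mul_one]

theorem eigen_pow {T : Module.End ℂ V} {v : V} {μ : ℂ} (h : T v = μ • v) (n : ℕ) :
    (T ^ n) v = μ ^ n • v := by
  induction n with
  | zero => simp
  | succ n ih => rw [pow_succ, Module.End.mul_apply, h, map_smul, ih, smul_smul, mul_comm, pow_succ]

theorem eigen_pow_eq_one {T : Module.End ℂ V} {v : V} {μ : ℂ} {p : ℕ} (hT : T ^ p = 1)
    (h0 : v ≠ 0) (h : T v = μ • v) : μ ^ p = 1 := by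
  have := eigen_pow h p
  rw [hT, Module.End.one_apply] at this
  by_contra hne
  have h2 : (μ ^ p - 1) • v = 0 := by rw [sub_smul, one_smul, ← this, sub_self]
  exact (smul_eq_zero.1 h2).elim (fun e => hne (sub_eq_zero.1 e)) h0

theorem exists_flip (S : IsSpin π ρ) {p : ℕ} (hp : p.Prime) (hp2 : Odd p) {d : G}
    (hd : (π d).IsCycle) (hcard : (π d).support.card = p) (hdp : ρ d ^ p = 1) {v : V} (h0 : v ≠ 0)
    {θ x : ℂ} (hv : ρ d v = θ • v) (hθ : θ ≠ 1) (hx : x ^ p = 1) (hx1 : x ≠ 1) :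
    ∃ a, (π a).support ⊆ (π d).support ∧ ρ d (ρ a v) = x • ρ a v := by
  have : Fact p.Prime := ⟨hp⟩
  have : NeZero p := ⟨hp.ne_zero⟩
  have hprim : IsPrimitiveRoot θ p := by
    have := orderOf_eq_prime (eigen_pow_eq_one hdp h0 hv) hθ
    rw [← this]
    exact IsPrimitiveRoot.orderOf θ
  obtain ⟨u, hu, rfl⟩ := hprim.eq_pow_of_pow_eq_one hx
  have hu0 : 0 < u := Nat.pos_of_ne_zero (by rintro rfl; exact hx1 (pow_zero _))
  have hcop : p.Coprime u := Nat.coprime_of_lt_prime hu0.ne' hu hp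
  obtain ⟨b, hb, hbd⟩ := hd.exists_conj_pow (u := u) (by rwa [hd.orderOf, hcard])
  obtain ⟨a, ha⟩ := S.surj b⁻¹
  refine ⟨a, by rwa [ha, Perm.support_inv], ?_⟩
  have h1 : ρ (a⁻¹ * d * a) = ρ (d ^ u) := by
    refine S.odd_lift_unique hp2 ?_ ?_ ?_
    · rw [map_mul, map_mul, map_inv, ha, inv_inv, hbd, map_pow]
    · have := conj_pow_eq_one (a := a⁻¹) hdp
      rwa [inv_inv] at this
    · rw [map_pow, ← pow_mul, mul_comm, pow_mul, hdp, one_pow]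
  have h2 : ρ d (ρ a v) = ρ a (ρ (a⁻¹ * d * a) v) := by
    rw [← rho_mul_apply, ← rho_mul_apply]
    simp only [mul_assoc, mul_inv_cancel_left]
  rw [h2, h1, rho_pow_eigen hv, map_smul]

theorem flip_mul (S : IsSpin π ρ) {y d a : G} (hd : π d ∈ (π y).cycleFactorsFinset)
    (hds : (π d).sign = 1) (hys : (π y).sign = 1) (ha : (π a).support ⊆ (π d).support)
    {v : V} (h0 : v ≠ 0) {θ x ξ : ℂ} (hv : ρ d v = θ • v) (hx : ρ d (ρ a v) = x • ρ a v)
    (hy : ρ y v = ξ • v) : ρ y (ρ a v) = (ξ * (x / θ)) • ρ a v := by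
  have h1 := Perm.disjoint_mul_inv_of_mem_cycleFactorsFinset hd
  rw [← map_inv, ← map_mul] at h1
  have h2 : ρ (y * d⁻¹) * ρ a = ρ a * ρ (y * d⁻¹) := by
    refine S.comm_of_sign_left ?_ ?_
    · rw [Perm.disjoint_iff_disjoint_support] at h1 ⊢
      exact h1.mono_right ha
    · rw [map_mul, map_inv, Perm.sign_mul, Perm.sign_inv, hds, hys, one_mul]
  have h3 : ρ y (ρ a v) = ρ (y * d⁻¹) (ρ d (ρ a v)) := by
    rw [← rho_mul_apply (y * d⁻¹), inv_mul_cancel_right]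
  rw [h3, hx, map_smul, ← Module.End.mul_apply, h2, Module.End.mul_apply, rho_mul_apply,
    rho_inv_eigen (eigen_ne_zero h0 hv) hv, map_smul, hy, map_smul, map_smul, smul_smul, smul_smul]
  congr 1
  ring

theorem exists_pattern_vectors [FiniteDimensional ℂ V] (S : IsSpin π ρ) {c : G} {p r : ℕ}
    (hc : (π c).IsCycle) (hp : p.Prime) (hp2 : Odd p) (hr : Even r) (hr0 : 0 < r)
    (hcard : (π c).support.card = p * r) {D : Finset α} (hcD : (π c).support ⊆ D) {m : ℕ}
    (hm : m ≤ r) (hDm : ∀ j < m, p * j + 4 ≤ D.card) {W : Submodule ℂ V} (hW0 : W ≠ ⊥)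
    (hW : Inv π ρ W D) :
    ∃ d : ℕ → G, (∀ j, ρ c * ρ (d j) = ρ (d (j + 1)) * ρ c) ∧ (∀ j, ρ (d (j + r)) = ρ (d j)) ∧
      ∃ (θ : ℕ → ℂ) (ξ : ℂ), (∀ j < r, θ j ^ p = 1) ∧ (∀ j < m, θ j ≠ 1) ∧
      ∀ φ : ℕ → ℂ, (∀ j < r, φ j ^ p = 1 ∧ (φ j = 1 ↔ θ j = 1)) → ∃ v ∈ W, v ≠ 0 ∧
        (∀ j < r, ρ (d j) v = φ j • v) ∧
        ρ (c ^ r) v = (ξ * ∏ j ∈ Finset.range r, (φ j / θ j)) • v := by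
  have hp3 : 3 ≤ p := by have := hp.two_le; obtain ⟨k, hk⟩ := hp2; omega
  obtain ⟨τ, hτ, hτp, hτc, hτm, hτd⟩ := hc.exists_conj_family hp.two_le hr0 hcard
  obtain ⟨d₀, rfl, hd₀⟩ := S.exists_odd_lift hp2 (τ := τ) (p := p) (by
    rw [← hτp, ← hτ.orderOf, pow_orderOf_eq_one])
  set d : ℕ → G := fun j => c ^ j * d₀ * (c ^ j)⁻¹ with hd
  have hπd : ∀ j, π (d j) = π c ^ j * π d₀ * (π c ^ j)⁻¹ := fun j => by
    simp only [hd, map_mul, map_inv, map_pow]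
  simp only [← hπd] at hτm hτd
  have hdp : ∀ j, ρ (d j) ^ p = 1 := fun j => conj_pow_eq_one hd₀
  have hdcyc : ∀ j, (π (d j)).IsCycle := fun j => by rw [hπd]; exact hτ.conj
  have hdcard : ∀ j, (π (d j)).support.card = p := fun j => by
    rw [hπd, Perm.card_support_conj, hτp]
  have hds : ∀ j, (π (d j)).sign = 1 := fun j =>
    sign_of_isCycle_odd (hdcyc j) (by rwa [hdcard])
  have hdc : ∀ j, (π (d j)).support ⊆ D := fun j => by
    refine (Perm.mem_cycleFactorsFinset_support_le (hτm j)).trans ?_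
    exact (Perm.support_pow_le _ _).trans hcD
  have hper : ∀ j, ρ (d (j + r)) = ρ (d j) := fun j =>
    S.odd_lift_unique hp2 (MonoidHom.map_conj_pow_add hτc j) (hdp _) (hdp _)
  have hys : (π (c ^ r)).sign = 1 := by
    rw [map_pow, map_pow]
    rcases Int.units_eq_one_or (π c).sign with h | h <;> rw [h]
    · exact one_pow r
    · exact hr.neg_one_pow
  have hydc : ∀ j, ρ (c ^ r) * ρ (d j) = ρ (d j) * ρ (c ^ r) := fun j =>
    S.odd_lift_comm hp2 (hdp j) (by
      rw [map_pow]; exact (Perm.self_mem_cycle_factors_commute (hτm j)).symm)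
  have hddc : ∀ i < r, ∀ j < r, i ≠ j → ρ (d i) * ρ (d j) = ρ (d j) * ρ (d i) := by
    intro i hi j hj hij
    refine S.comm_of_sign_left (Perm.disjoint_iff_disjoint_support.2 ?_) (hds i)
    rcases lt_or_gt_of_ne hij with h | h
    · exact hτd i j h hj
    · exact (hτd j i h hi).symm
  obtain ⟨W₁, hW₁, hW₁0, θ₁, hθ₁⟩ := S.exists_chain (d := d) hp.ne_zero hdp hds hW0 hW m
    (fun j _ => hdc j) (fun i j hij hj => hτd i j hij (hj.trans_le hm)) (by
      intro j hj W' hW'0 hW'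
      refine S.cycle_nontrivial hW'0 hW' (hdcyc j) ?_ (by rw [hdcard]; exact hp3) ?_
      · intro x hx
        rw [Finset.mem_sdiff, Finset.mem_biUnion]
        refine ⟨hdc j hx, ?_⟩
        rintro ⟨i, hi, hxi⟩
        exact Finset.disjoint_left.1 (hτd i j (Finset.mem_range.1 hi) (hj.trans_le hm)) hxi hx
      · have h1 := Finset.le_card_sdiff ((Finset.range j).biUnion fun i => (π (d i)).support) D
        have h2 := Finset.card_biUnion_le_card_mul (Finset.range j)
          (fun i => (π (d i)).support) p (fun i _ => (hdcard i).le)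
        rw [Finset.card_range, mul_comm] at h2
        have := hDm j hj
        omega)
  let W₂ : Submodule ℂ V :=
    { carrier := {v | v ∈ W ∧ ∀ j < m, ρ (d j) v = θ₁ j • v}
      add_mem' := fun ha hb => ⟨W.add_mem ha.1 hb.1, fun j hj => by
        rw [map_add, ha.2 j hj, hb.2 j hj, smul_add]⟩
      zero_mem' := ⟨W.zero_mem, fun j _ => by rw [map_zero, smul_zero]⟩
      smul_mem' := fun k v hv => ⟨W.smul_mem k hv.1, fun j hj => by
        rw [map_smul, hv.2 j hj, smul_comm]⟩ }
  have hW₂0 : W₂ ≠ ⊥ := by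
    obtain ⟨v, hv, h0⟩ := Submodule.exists_mem_ne_zero_of_ne_bot hW₁0
    have : v ∈ W₂ := ⟨hW₁ hv, fun j hj => (hθ₁ j hj).2 v hv⟩
    intro e
    rw [e] at this
    exact h0 this
  obtain ⟨v₀, hv₀, hv₀0, θ, hθ⟩ := Module.End.exists_joint_eigenvector
    (fun i => if i < r then ρ (d i) else ρ (c ^ r)) (r + 1) (by
      intro i _ j _
      split_ifs with hi hj hj
      · by_cases hij : i = j
        · rw [hij]
        · exact hddc i hi j hj hij
      · exact (hydc i).symm
      · exact hydc j
      · rfl) hW₂0 (by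
      intro i _ v hv
      split_ifs with hi
      · refine ⟨hW _ (hdc i) v hv.1, fun j hj => ?_⟩
        by_cases hij : i = j
        · rw [hij, hv.2 j hj, map_smul, hv.2 j hj]
        · rw [← Module.End.mul_apply, hddc j (hj.trans_le hm) i hi (Ne.symm hij),
            Module.End.mul_apply, hv.2 j hj, map_smul]
      · refine ⟨hW _ ?_ v hv.1, fun j hj => ?_⟩
        · rw [map_pow]; exact (Perm.support_pow_le _ _).trans hcD
        · rw [← Module.End.mul_apply, ← hydc, Module.End.mul_apply, hv.2 j hj, map_smul])
  have hθd : ∀ j < r, ρ (d j) v₀ = θ j • v₀ := fun j hj => by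
    have := hθ j (by omega)
    rwa [if_pos hj] at this
  have hθy : ρ (c ^ r) v₀ = θ r • v₀ := by
    have := hθ r (by omega)
    rwa [if_neg (lt_irrefl _)] at this
  have hθ1 : ∀ j < m, θ j ≠ 1 := by
    intro j hj e
    have h1 := hθd j (hj.trans_le hm)
    rw [hv₀.2 j hj] at h1
    exact (hθ₁ j hj).1 (by rw [smul_left_injective ℂ hv₀0 h1, e])
  have hθp : ∀ j < r, θ j ^ p = 1 := fun j hj => eigen_pow_eq_one (hdp j) hv₀0 (hθd j hj)
  refine ⟨d, fun j => mul_conj_pow c d₀ j, hper, θ, θ r, hθp, hθ1, fun φ hφ => ?_⟩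
  refine pattern_induction (P := fun φ ξ => ∃ v ∈ W, v ≠ 0 ∧ (∀ j < r, ρ (d j) v = φ j • v) ∧
      ρ (c ^ r) v = ξ • v) (R := fun x z => x ≠ 1 ∧ z ≠ 1 ∧ z ^ p = 1) ?_ ?_
    ⟨v₀, hv₀.1, hv₀0, hθd, hθy⟩ (fun j hj => eigen_ne_zero hv₀0 (hθd j hj)) ?_
  · rintro θ θ' ξ h ⟨v, hv, h0, h1, h2⟩
    exact ⟨v, hv, h0, fun j hj => by rw [← h j hj, h1 j hj], h2⟩
  · rintro θ ξ i x hi ⟨v, hv, h0, h1, h2⟩ ⟨hθi, hx1, hxp⟩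
    obtain ⟨a, ha, hax⟩ := S.exists_flip hp hp2 (hdcyc i) (hdcard i) (hdp i) h0 (h1 i hi)
      hθi hxp hx1
    refine ⟨ρ a v, hW a (ha.trans (hdc i)) v hv, rho_ne_zero a h0, fun j hj => ?_,
      S.flip_mul (by rw [map_pow]; exact hτm i) (hds i) hys ha h0 (h1 i hi) hax h2⟩
    by_cases hij : j = i
    · subst hij; rw [Function.update_self, hax]
    · rw [Function.update_of_ne hij, ← Module.End.mul_apply,
        S.comm_of_sign_left (b := a) ?_ (hds j),
        Module.End.mul_apply, h1 j hj, map_smul]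
      rw [Perm.disjoint_iff_disjoint_support]
      refine Disjoint.mono_right ha ?_
      rcases lt_or_gt_of_ne hij with h | h
      · exact hτd j i h hi
      · exact (hτd i j h hj).symm
  · intro j hj
    by_cases h : θ j = 1
    · left; rw [h]; exact (hφ j hj).2.2 h
    · right; exact ⟨h, fun e => h ((hφ j hj).2.1 e), (hφ j hj).1⟩

theorem full_of_odd_prime [FiniteDimensional ℂ V] (S : IsSpin π ρ) {c : G} {p r : ℕ}
    (hc : (π c).IsCycle) (hp : p.Prime) (hp2 : Odd p) (hr : Even r) (hr0 : 0 < r)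
    (hpr : p = 3 → r ≠ 2) (hcard : (π c).support.card = p * r) :
    Full π ρ c (π c).support := by
  intro W hW0 hW η hη
  have hp3 : 3 ≤ p := by have := hp.two_le; obtain ⟨k, hk⟩ := hp2; omega
  have hr2 : 2 ≤ r := by obtain ⟨k, hk⟩ := hr; omega
  obtain ⟨v, hv, h0⟩ := Submodule.exists_mem_ne_zero_of_ne_bot hW0
  have : Nontrivial V := ⟨v, 0, h0⟩
  have hη0 : η ≠ 0 := root_ne_zero hη (orderOf_pos _).ne'
  rw [hc.orderOf, hcard] at hη
  obtain ⟨d, hd, hper, θ, ξ, hθp, hθ1, h⟩ := S.exists_pattern_vectors hc hp hp2 hr hr0 hcard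
    subset_rfl (m := if p = 3 then r - 1 else r) (by split_ifs <;> omega) (by
      intro j hj
      rw [hcard]
      split_ifs at hj with h
      · rw [h]; omega
      · have h5 : 5 ≤ p := by obtain ⟨k, hk⟩ := hp2; omega
        obtain ⟨t, rfl⟩ := Nat.exists_eq_add_of_lt hj
        nlinarith) hW0 hW
  obtain ⟨v₁, hv₁, hv₁0, hv₁d, hv₁y⟩ := h θ fun j hj => ⟨hθp j hj, Iff.rfl⟩
  have hθ0 : ∀ j < r, θ j ≠ 0 := fun j hj => eigen_ne_zero hv₁0 (hv₁d j hj)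
  rw [Finset.prod_congr rfl fun j hj => div_self (hθ0 j (Finset.mem_range.1 hj)),
    Finset.prod_const_one, mul_one] at hv₁y
  have hξ0 : ξ ≠ 0 := eigen_ne_zero hv₁0 hv₁y
  have hΘ0 : ∏ j ∈ Finset.range r, θ j ≠ 0 :=
    Finset.prod_ne_zero_iff.2 fun j hj => hθ0 j (Finset.mem_range.1 hj)
  have hx : (η ^ r * (∏ j ∈ Finset.range r, θ j) / ξ) ^ p = 1 := by
    have h1 := rho_pow_eigen hv₁y p
    rw [← pow_mul, map_pow, mul_comm r, hη, LinearMap.smul_apply, Module.End.one_apply] at h1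
    have h2 : η ^ (p * r) = ξ ^ p := smul_left_injective ℂ hv₁0 h1
    rw [div_pow, mul_pow, ← Finset.prod_pow, Finset.prod_congr rfl fun j hj =>
      hθp j (Finset.mem_range.1 hj), Finset.prod_const_one, mul_one, ← pow_mul, mul_comm r, h2]
    exact div_self (pow_ne_zero _ hξ0)
  obtain ⟨φ, m, Q, hφ, hφx, hm0, hmr, hQ⟩ : ∃ (φ : ℕ → ℂ) (m : ℕ) (Q : ℂ → Prop),
      (∀ j < r, φ j ^ p = 1 ∧ (φ j = 1 ↔ θ j = 1)) ∧
      ∏ j ∈ Finset.range r, φ j = η ^ r * (∏ j ∈ Finset.range r, θ j) / ξ ∧ 0 < m ∧ m < r ∧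
      ∀ j < r, Q (φ j) ↔ j < m := by
    by_cases h3 : p = 3
    · subst h3
      have := hpr rfl
      obtain ⟨φ, m, Q, h1, h2⟩ := exists_pattern_three (r := r) (by
        obtain ⟨k, hk⟩ := hr; omega) hx (θ (r - 1))
      refine ⟨φ, m, Q, fun j hj => ⟨(h1 j hj).1, (h1 j hj).2.trans ?_⟩, h2⟩
      by_cases hj1 : j = r - 1
      · rw [hj1]; simp
      · have := hθ1 j (by rw [if_pos rfl]; omega)
        simp [hj1, this]
    · obtain ⟨φ, m, Q, h1, h2⟩ := exists_pattern (r := r) hp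
        (by obtain ⟨k, hk⟩ := hp2; omega) hr2 (by rintro rfl; exact absurd hr (by decide)) hx
      refine ⟨φ, m, Q, fun j hj => ⟨(h1 j hj).1, ?_⟩, h2⟩
      have := hθ1 j (by rwa [if_neg h3])
      simp [(h1 j hj).2, this]
  obtain ⟨w, hw, hw0, hwd, hwy⟩ := h φ hφ
  refine Module.End.exists_eigenvector_of_shift (c := ρ c) (d := fun j => ρ (d j)) hr0 hd hper
    (hW c subset_rfl) hw hw0 (θ := fun j => φ (j % r)) ?_
    (fun s hs hsr => exists_ne_shift hm0 hmr hQ hs hsr) hη0 ?_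
  · intro j
    have hmod : ∀ j, ρ (d j) = ρ (d (j % r)) := by
      intro j
      conv_lhs => rw [← Nat.mod_add_div j r]
      induction j / r with
      | zero => simp
      | succ k ih => rw [Nat.mul_succ, ← add_assoc, hper, ih]
    rw [hmod, hwd _ (Nat.mod_lt _ hr0)]
  · rw [← map_pow, hwy, Finset.prod_div_distrib, hφx]
    congr 1
    field_simp

/-- The square of a `6`-cycle. -/
theorem full_mul_self_of_six [FiniteDimensional ℂ V] (S : IsSpin π ρ) {c : G}
    (hc : (π c).IsCycle) (hcard : (π c).support.card = 6) {D : Finset α}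
    (hD : (π c).support ⊆ D) (hD7 : 7 ≤ D.card) : Full π ρ (c * c) D := by
  intro W hW0 hW ν hν
  have hord : orderOf (π (c * c)) = 3 := by
    rw [map_mul, ← pow_two, orderOf_pow, hc.orderOf, hcard]; rfl
  have : Nontrivial V := by
    obtain ⟨v, -, h0⟩ := Submodule.exists_mem_ne_zero_of_ne_bot hW0
    exact ⟨v, 0, h0⟩
  have hν0 : ν ≠ 0 := root_ne_zero hν (orderOf_pos _).ne'
  rw [hord, ← pow_two, map_pow] at hν
  obtain ⟨d, -, -, θ, ξ, hθp, hθ1, h⟩ := S.exists_pattern_vectors (r := 2) hc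
    Nat.prime_three (by decide)
    even_two two_pos hcard hD le_rfl (fun j hj => by omega) hW0 hW
  obtain ⟨v₁, hv₁, hv₁0, hv₁d, hv₁y⟩ := h θ fun j hj => ⟨hθp j hj, Iff.rfl⟩
  have hθ0 : ∀ j < 2, θ j ≠ 0 := fun j hj => eigen_ne_zero hv₁0 (hv₁d j hj)
  have h00 := hθ0 0 (by norm_num)
  have h10 := hθ0 1 (by norm_num)
  simp only [Finset.prod_range_succ, Finset.prod_range_zero, one_mul] at h hv₁y
  rw [div_self h00, div_self h10, mul_one, mul_one] at hv₁y
  have hξ0 : ξ ≠ 0 := eigen_ne_zero hv₁0 hv₁y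
  have hξ : ν ^ 3 = ξ ^ 3 := by
    have h1 := rho_pow_eigen hv₁y 3
    rw [map_pow, map_pow, hν, LinearMap.smul_apply, Module.End.one_apply] at h1
    exact smul_left_injective ℂ hv₁0 h1
  obtain ⟨ω, hω, hω1, hall⟩ := exists_cube_root
  have hω2 : ω ^ 2 ≠ 1 := fun h => hω1 (by rw [← hω, pow_succ, h, one_mul])
  obtain ⟨x, y, hx, hy, hx1, hy1, hxy⟩ : ∃ x y : ℂ, x ^ 3 = 1 ∧ y ^ 3 = 1 ∧ x ≠ 1 ∧ y ≠ 1 ∧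
      x * y = ν / ξ * (θ 0 * θ 1) := by
    have hω23 : (ω ^ 2) ^ 3 = 1 := by rw [← pow_mul, mul_comm, pow_mul, hω, one_pow]
    obtain ⟨i, hi, hi3, he⟩ := hall (ν / ξ * (θ 0 * θ 1)) (by
      rw [mul_pow, mul_pow, hθp 0 (by norm_num), hθp 1 (by norm_num), div_pow, hξ,
        div_self (pow_ne_zero _ hξ0), one_mul, one_mul])
    rw [he]
    interval_cases i
    · exact ⟨ω ^ 2, ω ^ 2, hω23, hω23, hω2, hω2, by
        rw [← pow_add, pow_succ _ 3, hω, one_mul, pow_one]⟩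
    · exact ⟨ω, ω, hω, hω, hω1, hω1, (pow_two ω).symm⟩
    · exact ⟨ω ^ 2, ω, hω23, hω, hω2, hω1, (pow_succ ω 2).symm⟩
  obtain ⟨w, hw, hw0, -, hwy⟩ := h (fun j => if j = 0 then x else y) (by
    intro j hj
    have := hθ1 j hj
    split_ifs
    · exact ⟨hx, by simp [hx1, this]⟩
    · exact ⟨hy, by simp [hy1, this]⟩)
  refine ⟨w, hw, hw0, ?_⟩
  rw [← pow_two, hwy, if_pos rfl, if_neg one_ne_zero]
  congr 1
  have : ξ * (x / θ 0 * (y / θ 1)) = ξ * (x * y) / (θ 0 * θ 1) := by field_simp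
  rw [this, hxy]
  field_simp

theorem full_of_four_dvd [FiniteDimensional ℂ V] (S : IsSpin π ρ) {c : G} {r : ℕ}
    (hc : (π c).IsCycle) (hr : Even r) (hr3 : 3 ≤ r) (hcard : (π c).support.card = 4 * r) :
    Full π ρ c (π c).support := by
  intro W hW0 hW η hη
  have hr0 : 0 < r := by omega
  have hη0 : η ≠ 0 := by
    obtain ⟨v, -, h0⟩ := Submodule.exists_mem_ne_zero_of_ne_bot hW0
    have : Nontrivial V := ⟨v, 0, h0⟩
    exact root_ne_zero hη (orderOf_pos _).ne'
  rw [hc.orderOf, hcard] at hη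
  obtain ⟨τ, hτ, hτp, hτc, hτm, hτd⟩ := hc.exists_conj_family (by norm_num) hr0 hcard
  obtain ⟨a, rfl⟩ := S.surj τ
  set b : ℕ → G := fun j => c ^ j * a * (c ^ j)⁻¹ with hb
  set q : ℕ → G := fun j => c ^ j * (a * a) * (c ^ j)⁻¹ with hq
  have hqb : ∀ j, q j = b j * b j := fun j => by
    simp only [hq, hb, mul_assoc, inv_mul_cancel_left]
  have hπb : ∀ j, π (b j) = π c ^ j * π a * (π c ^ j)⁻¹ := fun j => by
    simp only [hb, map_mul, map_inv, map_pow]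
  simp only [← hπb] at hτm hτd
  have hbcyc : ∀ j, (π (b j)).IsCycle := fun j => by rw [hπb]; exact hτ.conj
  have hbcard : ∀ j, (π (b j)).support.card = 4 := fun j => by
    rw [hπb, Perm.card_support_conj, hτp]
  have hqs : ∀ j, (π (q j)).sign = 1 := fun j => by
    rw [hqb, map_mul, map_mul]; exact Int.units_mul_self _
  have hqsub : ∀ j, (π (q j)).support ⊆ (π (b j)).support := fun j => by
    rw [hqb, map_mul]; exact support_mul_subset subset_rfl subset_rfl
  have hbc : ∀ j, (π (b j)).support ⊆ (π c).support := fun j =>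
    (Perm.mem_cycleFactorsFinset_support_le (hτm j)).trans (Perm.support_pow_le _ _)
  have hper : ∀ j, ρ (q (j + r)) = ρ (q j) := fun j => by
    rw [hqb, hqb, map_mul ρ (b (j + r)), map_mul ρ (b j)]
    exact S.lift_mul_self (MonoidHom.map_conj_pow_add hτc j)
  have hshift : ∀ j, ρ c * ρ (q j) = ρ (q (j + 1)) * ρ c := fun j => mul_conj_pow c (a * a) j
  have hyq : ∀ j, ρ (c ^ r) * ρ (q j) = ρ (q j) * ρ (c ^ r) := by
    intro j
    conv_rhs => rw [← hper]
    rw [← map_mul, ← map_mul]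
    congr 1
    simp only [hq, add_comm j, pow_add, mul_inv_rev, mul_assoc, inv_mul_cancel, mul_one]
  have hys : (π (c ^ r)).sign = 1 := by
    rw [map_pow, map_pow]
    rcases Int.units_eq_one_or (π c).sign with h | h <;> rw [h]
    · exact one_pow r
    · exact hr.neg_one_pow
  have hqbc : ∀ i < r, ∀ j < r, i ≠ j → ∀ x, (π x).support ⊆ (π (b j)).support →
      ρ (q i) * ρ x = ρ x * ρ (q i) := by
    intro i hi j hj hij x hx
    refine S.comm_of_sign_left (Perm.disjoint_iff_disjoint_support.2 ?_) (hqs i)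
    refine Disjoint.mono (hqsub i) hx ?_
    rcases lt_or_gt_of_ne hij with h | h
    · exact hτd i j h hj
    · exact (hτd j i h hi).symm
  obtain ⟨ι, hι0, hι⟩ : ∃ ι : ℂ, ι ≠ 0 ∧ ∀ j, ρ (q j) * ρ (q j) = ι ^ 2 • (1 : Module.End ℂ V) := by
    have h4 : orderOf (π a) = 4 := by rw [hτ.orderOf, hτp]
    have hconj : ∀ j, ρ (q j) * ρ (q j) = ρ (c ^ j) * ρ a ^ 4 * ρ (c ^ j)⁻¹ := fun j => by
      rw [← map_pow, ← map_mul, ← map_mul, ← map_mul]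
      congr 1
      simp only [hq, pow_succ, pow_zero, one_mul, mul_assoc, inv_mul_cancel_left]
    rcases S.pow_orderOf a with h | h <;> rw [h4] at h
    · refine ⟨1, one_ne_zero, fun j => ?_⟩
      rw [hconj, h, mul_one, ← map_mul, mul_inv_cancel, map_one, one_pow, one_smul]
    · refine ⟨Complex.I, Complex.I_ne_zero, fun j => ?_⟩
      rw [hconj, h, mul_neg, neg_mul, mul_one, ← map_mul, mul_inv_cancel, map_one, Complex.I_sq,
        neg_smul, one_smul]
  obtain ⟨v₀, hv₀, hv₀0, θ, hθ⟩ := Module.End.exists_joint_eigenvector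
    (fun i => if i < r then ρ (q i) else ρ (c ^ r) * ρ (c ^ r)) (r + 1) (by
      intro i _ j _
      split_ifs with hi hj hj
      · by_cases hij : i = j
        · rw [hij]
        · exact hqbc i hi j hj hij _ (hqsub j)
      · exact ((show Commute _ _ from hyq i).mul_left (hyq i)).symm
      · exact (show Commute _ _ from hyq j).mul_left (hyq j)
      · rfl) hW0 (by
      intro i _ v hv
      split_ifs with hi
      · exact hW _ ((hqsub i).trans (hbc i)) v hv
      · have h1 : (π (c ^ r)).support ⊆ (π c).support := by
          rw [map_pow]; exact Perm.support_pow_le _ _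
        exact hW _ h1 _ (hW _ h1 v hv))
  have hθq : ∀ j < r, ρ (q j) v₀ = θ j • v₀ := fun j hj => by
    have := hθ j (by omega)
    rwa [if_pos hj] at this
  have hθy : ρ (c ^ r) (ρ (c ^ r) v₀) = θ r • v₀ := by
    have := hθ r (by omega)
    rwa [if_neg (lt_irrefl _)] at this
  have hθι : ∀ j < r, θ j = ι ∨ θ j = -ι := by
    intro j hj
    have h1 := LinearMap.congr_fun (hι j) v₀
    rw [Module.End.mul_apply, hθq j hj, map_smul, hθq j hj, smul_smul, LinearMap.smul_apply,
      Module.End.one_apply] at h1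
    have h2 : θ j * θ j = ι ^ 2 := smul_left_injective ℂ hv₀0 h1
    rw [← pow_two] at h2
    exact sq_eq_sq_iff_eq_or_eq_neg.1 h2
  have hθ0 : ∀ j < r, θ j ≠ 0 := fun j hj => eigen_ne_zero hv₀0 (hθq j hj)
  have key : ∀ φ : ℕ → ℂ, (∀ j < r, φ j = ι ∨ φ j = -ι) → ∃ v ∈ W, v ≠ 0 ∧
      (∀ j < r, ρ (q j) v = φ j • v) ∧
      ρ (c ^ r) (ρ (c ^ r) v) = (θ r * ∏ j ∈ Finset.range r, (φ j / θ j)) • v := by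
    intro φ hφ
    refine pattern_induction (P := fun φ ξ => ∃ v ∈ W, v ≠ 0 ∧ (∀ j < r, ρ (q j) v = φ j • v) ∧
      ρ (c ^ r) (ρ (c ^ r) v) = ξ • v) (R := fun x z => z = -x) ?_ ?_
      ⟨v₀, hv₀, hv₀0, hθq, hθy⟩ hθ0 ?_
    · rintro θ θ' ξ h ⟨v, hv, h0, h1, h2⟩
      exact ⟨v, hv, h0, fun j hj => by rw [← h j hj, h1 j hj], h2⟩
    · rintro θ ξ i x hi ⟨v, hv, h0, h1, h2⟩ rfl
      obtain ⟨σ, hσm, hσs⟩ := exists_odd_cycleFactor (σ := π (q i)) (e := 0) (by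
        rw [hqb, map_mul, ← pow_two, orderOf_pow, (hbcyc i).orderOf, hbcard]; rfl)
      obtain ⟨s, rfl⟩ := S.surj σ
      have hsb : (π s).support ⊆ (π (b i)).support :=
        (Perm.mem_cycleFactorsFinset_support_le hσm).trans (hqsub i)
      have hsq : ∀ v, ρ (q i) (ρ s v) = -ρ s (ρ (q i) v) := fun v => by
        have := LinearMap.congr_fun (S.cycleFactor_anticomm (hqs i) hσm hσs) v
        rw [LinearMap.neg_apply, Module.End.mul_apply, Module.End.mul_apply] at this
        rw [this, neg_neg]
      have hst : ρ (c ^ r * c ^ r * (q i)⁻¹) * ρ s = ρ s * ρ (c ^ r * c ^ r * (q i)⁻¹) := by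
        have hd := Perm.disjoint_mul_inv_of_mem_cycleFactorsFinset (hτm i)
        have hπt : π (c ^ r * c ^ r * (q i)⁻¹) =
            (π c ^ r * (π (b i))⁻¹) * (π c ^ r * (π (b i))⁻¹) := by
          have hcom : Commute (π c ^ r) (π (b i))⁻¹ :=
            (Perm.self_mem_cycle_factors_commute (hτm i)).symm.inv_right
          rw [hqb, map_mul, map_inv, map_mul, map_mul, map_pow, mul_inv_rev, mul_assoc,
            mul_assoc, ← mul_assoc (π c ^ r) (π (b i))⁻¹, hcom.eq, mul_assoc, ← hcom.eq]
        refine S.comm_of_sign_left ?_ (by rw [hπt, map_mul]; exact Int.units_mul_self _)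
        rw [hπt]
        rw [Perm.disjoint_iff_disjoint_support] at hd ⊢
        exact hd.mono (support_mul_subset subset_rfl subset_rfl) hsb
      refine ⟨ρ s v, hW s (hsb.trans (hbc i)) v hv, rho_ne_zero s h0, fun j hj => ?_, ?_⟩
      · by_cases hij : j = i
        · subst hij
          rw [Function.update_self, hsq, h1 j hj, map_smul, neg_smul]
        · rw [Function.update_of_ne hij, ← Module.End.mul_apply, hqbc j hj i hi hij s hsb,
            Module.End.mul_apply, h1 j hj, map_smul]
      · have h3 : ∀ u, ρ (c ^ r) (ρ (c ^ r) u) = ρ (c ^ r * c ^ r * (q i)⁻¹) (ρ (q i) u) := by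
          intro u
          rw [← rho_mul_apply, ← rho_mul_apply (c ^ r * c ^ r * (q i)⁻¹), inv_mul_cancel_right]
        rw [h3, hsq, map_neg, ← Module.End.mul_apply, hst, Module.End.mul_apply, ← h3, h2, map_smul,
          neg_div, div_self (eigen_ne_zero h0 (h1 i hi)), mul_neg_one, neg_smul]
    · intro j hj
      rcases hθι j hj with h | h <;> rcases hφ j hj with h' | h' <;> simp [h, h']
  have hΞ : ∃ m, 0 < m ∧ m < 3 ∧ θ r * ∏ j ∈ Finset.range r,
      ((if j < m then -ι else ι) / θ j) = (η ^ r) ^ 2 := by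
    have hprod : ∀ m < 3, ∏ j ∈ Finset.range r, (if j < m then -ι else ι) = (-1) ^ m * ι ^ r := by
      intro m hm
      have h1 : ∀ j, (if j < m then -ι else ι) = (if j < m then -1 else 1) * ι := fun j => by
        split_ifs <;> ring
      obtain ⟨k, rfl⟩ := Nat.exists_eq_add_of_le hr3
      rw [Finset.prod_congr rfl fun j _ => h1 j, Finset.prod_mul_distrib, Finset.prod_const,
        Finset.card_range, add_comm 3 k, Finset.prod_range_succ', Finset.prod_range_succ',
        Finset.prod_range_succ', Finset.prod_congr rfl (g := fun _ => (1 : ℂ)) (fun j _ => by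
          rw [if_neg (by omega)]), Finset.prod_const_one]
      interval_cases m <;> simp
    obtain ⟨v, -, h0, -, h2⟩ := key (fun j => if j < 1 then -ι else ι) (fun j _ => by
      split_ifs <;> simp)
    have h3 := eigen_pow (T := ρ (c ^ r) * ρ (c ^ r)) h2 2
    rw [← pow_two, ← pow_mul, map_pow, ← pow_mul, mul_comm, hη, LinearMap.smul_apply,
      Module.End.one_apply] at h3
    have h4 : _ = ((η ^ r) ^ 2) ^ 2 := (smul_left_injective ℂ h0 h3).symm.trans (by ring)
    rcases sq_eq_sq_iff_eq_or_eq_neg.1 h4 with h | h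
    · exact ⟨1, by norm_num, by norm_num, h⟩
    · refine ⟨2, by norm_num, by norm_num, ?_⟩
      rw [← neg_eq_iff_eq_neg] at h
      rw [← h, Finset.prod_div_distrib, Finset.prod_div_distrib, hprod 1 (by norm_num),
        hprod 2 (by norm_num)]
      ring
  obtain ⟨m, hm0, hm3, hm⟩ := hΞ
  obtain ⟨w, hw, hw0, hwq, hwy⟩ := key (fun j => if j < m then -ι else ι) (fun j _ => by
    split_ifs <;> simp)
  rw [hm] at hwy
  let W₁ : Submodule ℂ V :=
    { carrier := {v | v ∈ W ∧ ∀ j < r, ρ (q j) v = (if j < m then -ι else ι) • v}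
      add_mem' := fun ha hb => ⟨W.add_mem ha.1 hb.1, fun j hj => by
        rw [map_add, ha.2 j hj, hb.2 j hj, smul_add]⟩
      zero_mem' := ⟨W.zero_mem, fun j _ => by rw [map_zero, smul_zero]⟩
      smul_mem' := fun k v hv => ⟨W.smul_mem k hv.1, fun j hj => by
        rw [map_smul, hv.2 j hj, smul_comm]⟩ }
  obtain ⟨u, hu, hu0, huy⟩ : ∃ u ∈ W₁, u ≠ 0 ∧ ρ (c ^ r) u = η ^ r • u := by
    rcases eigen_or_neg (T := ρ (c ^ r)) (W := W₁) (by
      rintro v ⟨hv, hv'⟩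
      refine ⟨hW _ ?_ v hv, fun j hj => ?_⟩
      · rw [map_pow]; exact Perm.support_pow_le _ _
      · rw [← Module.End.mul_apply, ← hyq, Module.End.mul_apply, hv' j hj, map_smul])
      (v := w) ⟨hw, hwq⟩ hw0 hwy with h | ⟨u, hu, hu0, huy⟩
    · exact h
    · have hb0 : b 0 = a := by simp [hb]
      have hanti := S.cycleFactor_anticomm (a := c ^ r) (c := a) hys
        (by rw [map_pow, ← hb0]; exact hτm 0) (sign_of_isCycle hτ (by rw [hτp]; decide))
      refine ⟨ρ a u, ⟨hW a (by rw [← hb0]; exact hbc 0) u hu.1, fun j hj => ?_⟩,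
        rho_ne_zero a hu0, ?_⟩
      · have h1 : ρ (q j) * ρ a = ρ a * ρ (q j) := by
          by_cases hj0 : j = 0
          · rw [hj0, hqb, hb0, ← map_mul, ← map_mul, mul_assoc]
          · exact hqbc j hj 0 hr0 hj0 a (by rw [hb0])
        rw [← Module.End.mul_apply, h1, Module.End.mul_apply, hu.2 j hj, map_smul]
      · have := LinearMap.congr_fun hanti u
        rw [LinearMap.neg_apply, Module.End.mul_apply, Module.End.mul_apply, huy, map_smul,
          neg_smul] at this
        exact (neg_inj.1 this).symm
  refine Module.End.exists_eigenvector_of_shift (c := ρ c) (d := fun j => ρ (q j)) hr0 hshift hper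
    (hW c subset_rfl) hu.1 hu0 (θ := fun j => if j % r < m then -ι else ι) ?_
    (fun s hs hsr => exists_ne_shift (φ := fun j => if j < m then -ι else ι)
      (Q := fun z => z = -ι) hm0 (by omega) (fun j _ => ?_) hs hsr) hη0 ?_
  · intro j
    have hmod : ∀ j, ρ (q j) = ρ (q (j % r)) := by
      intro j
      conv_lhs => rw [← Nat.mod_add_div j r]
      induction j / r with
      | zero => simp
      | succ k ih => rw [Nat.mul_succ, ← add_assoc, hper, ih]
    rw [hmod, hu.2 _ (Nat.mod_lt _ hr0)]
  · split_ifs with h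
    · simp [h]
    · simp only [h, iff_false]
      intro e
      have : (2 : ℂ) * ι = 0 := by rw [two_mul]; nth_rewrite 1 [e]; exact neg_add_cancel ι
      exact hι0 ((mul_eq_zero.1 this).resolve_left two_ne_zero)
  · rw [← map_pow, huy]

theorem Full.mul_self {c : G} {D : Finset α} (h : Full π ρ c D) (he : Even (orderOf (π c))) :
    Full π ρ (c * c) D := by
  intro W hW0 hW ν hν
  obtain ⟨μ, rfl⟩ := exists_pow_root two_pos ν
  have ho : 2 * orderOf (π (c * c)) = orderOf (π c) := by
    rw [map_mul, ← pow_two, orderOf_pow_of_dvd two_ne_zero he.two_dvd,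
      Nat.mul_div_cancel' he.two_dvd]
  obtain ⟨w, hw, hw0, hwμ⟩ := h W hW0 hW μ (by
    rw [← ho, pow_mul, pow_mul, ← hν, map_mul ρ, pow_two])
  refine ⟨w, hw, hw0, ?_⟩
  rw [rho_mul_apply, hwμ, map_smul, hwμ, smul_smul, pow_two]

theorem full_mul_self_of_isCycle [FiniteDimensional ℂ V] (S : IsSpin π ρ) {c : G}
    (hc : (π c).IsCycle) (he : Even (π c).support.card) (h6 : (π c).support.card ≠ 6) :
    Full π ρ (c * c) (π c).support := by
  rcases Nat.eq_two_pow_or_exists_odd_prime_and_dvd (π c).support.card with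
    ⟨e, hl⟩ | ⟨p, hp, ⟨r, hr⟩, hp2⟩
  · obtain ⟨e, rfl⟩ : ∃ e', e = e' + 1 := Nat.exists_eq_succ_of_ne_zero (by
      rintro rfl
      rw [hl, pow_zero] at he
      exact absurd he (by decide))
    refine (S.full_of_two_pow e (a := c * c) ?_ ?_).mono ?_
    · rw [map_mul, map_mul]; exact Int.units_mul_self _
    · rw [map_mul, ← pow_two, orderOf_pow_of_dvd two_ne_zero (by rw [hc.orderOf]; exact he.two_dvd),
        hc.orderOf, hl, pow_succ, Nat.mul_div_cancel _ two_pos]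
    · rw [map_mul]; exact support_mul_subset subset_rfl subset_rfl
  · have hr2 : Even r := by
      rw [hr, Nat.even_mul] at he
      exact he.resolve_left (Nat.not_even_iff_odd.2 hp2)
    refine (S.full_of_odd_prime hc hp hp2 hr2 ?_ ?_ hr).mul_self (by rwa [hc.orderOf])
    · have := hc.two_le_card_support
      exact Nat.pos_of_ne_zero (by rintro rfl; omega)
    · rintro rfl rfl
      exact h6 hr

theorem full_mul_self_of_disjoint (S : IsSpin π ρ) {a s t : G} {D₁ D₂ : Finset α}
    (h₁ : Full π ρ (s * s) D₁) (h₂ : Full π ρ (t * t) D₂) (hd : (π s).Disjoint (π t))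
    (hD : Disjoint (π s).support D₂) (ha : π a = π s * π t) : Full π ρ (a * a) (D₁ ∪ D₂) := by
  have hsub : ∀ x : G, (π (x * x)).support ⊆ (π x).support := fun x => by
    rw [map_mul]; exact support_mul_subset subset_rfl subset_rfl
  refine (h₁.mul S h₂ ?_ ?_ (hD.mono_left (hsub s))).congr S ?_
  · rw [Perm.disjoint_iff_disjoint_support] at hd ⊢
    exact hd.mono (hsub s) (hsub t)
  · rw [map_mul, map_mul]; exact Int.units_mul_self _
  · rw [map_mul, map_mul, map_mul, map_mul, ha, mul_assoc, mul_assoc, ← mul_assoc (π t) (π s),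
      ← hd.commute.eq, mul_assoc]

theorem full_mul_self [FiniteDimensional ℂ V] (S : IsSpin π ρ) (σ : Perm α)
    (he : ∀ l ∈ σ.cycleType, Even l) (h6 : 6 ∉ σ.cycleType) :
    ∀ a, π a = σ → Full π ρ (a * a) σ.support := by
  induction σ using Perm.cycle_induction_on with
  | base_one =>
    intro a ha
    refine (S.full_of_two_pow 0 (a := a * a) ?_ ?_).mono ?_ <;> simp [ha]
  | base_cycles σ hσ =>
    rintro a rfl
    rw [hσ.cycleType] at he h6
    exact S.full_mul_self_of_isCycle hσ (he _ (by simp)) (by simpa [eq_comm] using h6)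
  | induction_disjoint σ τ hd hc ih₁ ih₂ =>
    intro a ha
    rw [hd.cycleType_mul] at he h6
    simp only [Multiset.mem_add, not_or] at he h6
    obtain ⟨s, rfl⟩ := S.surj σ
    obtain ⟨t, rfl⟩ := S.surj τ
    rw [hd.support_mul]
    exact S.full_mul_self_of_disjoint (ih₁ (fun l hl => he l (Or.inl hl)) h6.1 s rfl)
      (ih₂ (fun l hl => he l (Or.inr hl)) h6.2 t rfl) hd
      (Perm.disjoint_iff_disjoint_support.1 hd) ha

theorem full_mul_self_univ [FiniteDimensional ℂ V] (S : IsSpin π ρ) {g : G}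
    (hfix : (π g).support = Finset.univ) (he : ∀ l ∈ (π g).cycleType, Even l)
    (hparts : 2 ≤ Multiset.card (π g).cycleType) (hdist : (π g).cycleType.Nodup) :
    Full π ρ (g * g) Finset.univ := by
  by_cases h6 : 6 ∈ (π g).cycleType
  · obtain ⟨c, τ, hg, hd, hc, hcard⟩ := Perm.mem_cycleType_iff.1 h6
    obtain ⟨c, rfl⟩ := S.surj c
    obtain ⟨t, rfl⟩ := S.surj τ
    rw [hg, hd.cycleType_mul, hc.cycleType] at he hdist hparts
    have hu : (π t).support ∪ (π c).support = Finset.univ := by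
      rw [← hfix, hg, hd.support_mul, Finset.union_comm]
    have hd' := Perm.disjoint_iff_disjoint_support.1 hd
    have h7 : 7 ≤ (Finset.univ : Finset α).card := by
      rw [← hu, Finset.card_union_of_disjoint hd'.symm, hcard]
      have : (π t).support.card ≠ 0 := by
        intro h
        rw [Finset.card_eq_zero, Perm.support_eq_empty_iff] at h
        simp [h] at hparts
      omega
    have h6t : 6 ∉ (π t).cycleType := by
      rw [hcard] at hdist
      exact (Multiset.nodup_cons.1 hdist).1
    have := S.full_mul_self_of_disjoint (D₁ := Finset.univ)
      (S.full_mul_self_of_six hc hcard (Finset.subset_univ _) h7)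
      (S.full_mul_self (π t) (fun l hl => he l (by simp [hl])) h6t t rfl) hd hd' hg
    rwa [Finset.union_eq_left.2 (Finset.subset_univ _)] at this
  · rw [← hfix]
    exact S.full_mul_self (π g) he h6 g rfl

theorem exists_shift_ne {θ : ℕ → ℂ} {p q : ℕ} (hp : Odd p) (h1 : θ 0 ≠ 1) (hθp : θ 0 ^ p = 1)
    (hper : ∀ j, θ (j % (2 * q)) = θ j) (hq : θ q * θ 0 = 1)
    (hdiv : ∀ s < 2 * q, 0 < s → ∃ m < 2 * q, s * m % (2 * q) = q) {s : ℕ} (hs : 0 < s)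
    (hs2 : s < 2 * q) : ∃ j, θ j ≠ θ (j + s) := by
  by_contra! h
  obtain ⟨m, -, hm⟩ := hdiv s hs2 hs
  have hmul : ∀ m, θ (s * m) = θ 0 := fun m => by
    induction m with
    | zero => rw [mul_zero]
    | succ m ih => rw [Nat.mul_succ, ← h, ih]
  have h2 : θ q = θ 0 := by rw [← hm, hper, hmul]
  rw [h2, ← pow_two] at hq
  obtain ⟨n, rfl⟩ := hp
  rw [pow_succ, pow_mul, hq, one_pow, one_mul] at hθp
  exact h1 hθp

theorem eFull_of_inverted [FiniteDimensional ℂ V] (S : IsSpin π ρ) {h d : G} {p q : ℕ}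
    {D : Finset α} (hp : Odd p) (hdp : ρ d ^ p = 1) (hds : (π d).sign = 1)
    (hhs : (π h).sign = 1) (hq : orderOf (π h) = 2 * q)
    (hdiv : ∀ s < 2 * q, 0 < s → ∃ m < 2 * q, s * m % (2 * q) = q)
    (hinv : π h ^ q * π d * (π h ^ q)⁻¹ = (π d)⁻¹)
    (hcomm : ∀ j < 2 * q, Commute (π h ^ j * π d * (π h ^ j)⁻¹) (π d))
    (hhD : (π h).support ⊆ D) (hdD : (π d).support ⊆ D)
    (hne : ∀ W : Submodule ℂ V, W ≠ ⊥ → EInv π ρ W D → ∃ v ∈ W, ρ d v ≠ v) :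
    EFull π ρ h D := by
  intro W hW0 hW η hη
  have hq0 : 0 < 2 * q := hq ▸ orderOf_pos _
  have hη0 : η ≠ 0 := by
    obtain ⟨v, -, h0⟩ := Submodule.exists_mem_ne_zero_of_ne_bot hW0
    have : Nontrivial V := ⟨v, 0, h0⟩
    exact root_ne_zero hη (orderOf_pos _).ne'
  rw [hq] at hη
  set b : ℕ → G := fun j => h ^ j * d * (h ^ j)⁻¹ with hb
  have hb0 : b 0 = d := by simp [hb]
  have hπb : ∀ j, π (b j) = π h ^ j * π d * (π h ^ j)⁻¹ := fun j => by
    simp only [hb, map_mul, map_inv, map_pow]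
  have hbp : ∀ j, ρ (b j) ^ p = 1 := fun j => conj_pow_eq_one hdp
  have hper : ∀ j, ρ (b (j + 2 * q)) = ρ (b j) := fun j =>
    S.odd_lift_unique hp (MonoidHom.map_conj_pow_add (by
      rw [← hq, pow_orderOf_eq_one]; exact Commute.one_left _) j) (hbp _) (hbp _)
  have hmod : ∀ j, ρ (b (j % (2 * q))) = ρ (b j) := by
    intro j
    conv_rhs => rw [← Nat.mod_add_div j (2 * q)]
    induction j / (2 * q) with
    | zero => simp
    | succ k ih => rw [Nat.mul_succ, ← add_assoc, hper, ih]
  have hcomm' : ∀ i j, i ≤ j → j < 2 * q → ρ (b i) * ρ (b j) = ρ (b j) * ρ (b i) := by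
    intro i j hij hj
    obtain ⟨m, rfl⟩ := Nat.exists_eq_add_of_le hij
    refine S.odd_lift_comm hp (hbp _) ?_
    rw [hπb, hπb]
    have := (hcomm m (by omega)).symm
    rw [pow_add]
    have e : π h ^ i * π h ^ m * π d * (π h ^ i * π h ^ m)⁻¹ =
        π h ^ i * (π h ^ m * π d * (π h ^ m)⁻¹) * (π h ^ i)⁻¹ := by group
    rw [e]
    exact (Commute.conj_iff _).2 this
  have hcomm2 : ∀ i < 2 * q, ∀ j < 2 * q, ρ (b i) * ρ (b j) = ρ (b j) * ρ (b i) := by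
    intro i hi j hj
    rcases le_total i j with hij | hij
    · exact hcomm' i j hij hj
    · exact (hcomm' j i hij hi).symm
  have hbD : ∀ j, (π (b j)).support ⊆ D := fun j => by
    have h1 : (π h ^ j).support ⊆ D := (Perm.support_pow_le _ _).trans hhD
    rw [hπb]
    exact support_mul_subset (support_mul_subset h1 hdD) (by rwa [Perm.support_inv])
  have hbs : ∀ j, (π (b j)).sign = 1 := fun j => by
    rw [hπb, map_mul, map_mul, map_pow, map_inv, map_pow, hds, hhs]; simp
  obtain ⟨u, hu, hud⟩ := hne W hW0 hW
  obtain ⟨v, hv, hv0, μ, hμ1, hμ⟩ := Module.End.exists_eigenvector_ne_one (Nat.pos_of_ne_zero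
    (by rintro rfl; exact absurd hp (by decide))).ne' hdp (hW d hdD hds) hu hud
  obtain ⟨w, hw, hw0, θ, hθ⟩ := Module.End.exists_joint_eigenvector (fun j => ρ (b j)) (2 * q)
    hcomm2 (Module.End.inf_eigenspace_ne_bot hv hv0 hμ) (by
      rintro j hj v ⟨hv, hv'⟩
      refine ⟨hW _ (hbD j) (hbs j) v hv, ?_⟩
      have hv' := Module.End.mem_eigenspace_iff.1 hv'
      refine Module.End.mem_eigenspace_iff.2 ?_
      have := hcomm2 0 hq0 j hj
      rw [hb0] at this
      rw [← Module.End.mul_apply, this, Module.End.mul_apply, hv', map_smul])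
  have hwd := Module.End.mem_eigenspace_iff.1 hw.2
  have hθ' : ∀ j, ρ (b j) w = θ (j % (2 * q)) • w := fun j => by
    rw [← hmod]; exact hθ _ (Nat.mod_lt _ hq0)
  have hθ0 : θ 0 = μ := by
    have := hθ 0 hq0
    rw [hb0, hwd] at this
    exact (smul_left_injective ℂ hw0 this).symm
  have hw1 : ∀ x : ℂ, x • w = w → x = 1 := fun x hx =>
    smul_left_injective ℂ hw0 (hx.trans (one_smul ℂ w).symm)
  refine Module.End.exists_eigenvector_of_shift (c := ρ h) (d := fun j => ρ (b j)) hq0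
    (mul_conj_pow h d) hper (hW h hhD hhs) hw.1 hw0 (θ := fun j => θ (j % (2 * q))) hθ'
    (fun s hs hsq => exists_shift_ne hp ?_ ?_ (fun j => by simp) ?_ hdiv hs hsq) hη0 ?_
  · simpa [hθ0] using hμ1
  · refine hw1 _ ?_
    have := rho_pow_eigen (hθ' 0) p
    rw [← this, map_pow, hbp]
    rfl
  · refine hw1 _ ?_
    have hqi : ρ (b q) = ρ d⁻¹ := S.odd_lift_unique hp (by rw [hπb, hinv, map_inv]) (hbp _) (by
      have : ρ d⁻¹ ^ p * ρ d ^ p = 1 := by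
        rw [← map_pow, ← map_pow, ← map_mul, inv_pow, inv_mul_cancel, map_one]
      rwa [hdp, mul_one] at this)
    have h1 := hθ' q
    have h2 := hθ' 0
    rw [hb0] at h2
    rw [mul_comm, mul_smul, ← h1, ← map_smul, ← h2, hqi, rho_inv_apply]
  · rw [hη]; rfl

end IsSpin

namespace Equiv.Perm

theorem exists_hom_of_cycleType_eq {α β : Type*} [Fintype α] [DecidableEq α] [Fintype β]
    [DecidableEq β] {σ₀ : Perm β} {σ : Perm α} (h₀ : σ₀.support = Finset.univ)
    (h : σ₀.cycleType = σ.cycleType) :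
    ∃ (Φ : Perm β →* Perm α) (e : β → α), Function.Injective e ∧ Φ σ₀ = σ ∧
      (∀ x y, Φ (swap x y) = swap (e x) (e y)) ∧ ∀ x, e x ∈ σ.support := by
  have hcard : Fintype.card β ≤ Fintype.card α := by
    rw [← Finset.card_univ, ← h₀, ← sum_cycleType, h, sum_cycleType]
    exact Finset.card_le_univ _
  obtain ⟨e₀⟩ := Function.Embedding.nonempty_of_card_le hcard
  have hct : (viaEmbedding σ₀ e₀).cycleType = σ₀.cycleType := by
    rw [viaEmbedding]
    convert cycleType_extendDomain _
  obtain ⟨τ, hτ⟩ := _root_.isConj_iff.1 (isConj_iff_cycleType_eq.2 (hct.trans h))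
  refine ⟨(MulAut.conj τ).toMonoidHom.comp (viaEmbeddingHom e₀), τ ∘ e₀,
    τ.injective.comp e₀.injective, hτ, fun x y => ?_, fun x => ?_⟩
  · have : viaEmbedding (swap x y) e₀ = swap (e₀ x) (e₀ y) := by
      ext z
      by_cases hz : z ∈ Set.range e₀
      · obtain ⟨z, rfl⟩ := hz
        rw [viaEmbedding_apply, e₀.injective.swap_apply]
      · rw [viaEmbedding_apply_of_notMem _ _ _ hz, swap_apply_of_ne_of_ne]
        · rintro rfl; exact hz ⟨x, rfl⟩
        · rintro rfl; exact hz ⟨y, rfl⟩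
    change τ * viaEmbedding (swap x y) e₀ * τ⁻¹ = _
    rw [this, Function.comp, Function.comp, ← swap_apply_apply]
  · rw [mem_support, ← hτ, Function.comp_apply, mul_apply, mul_apply, inv_def, symm_apply_apply,
      viaEmbedding_apply, τ.injective.ne_iff, e₀.injective.ne_iff, ← mem_support, h₀]
    exact Finset.mem_univ x

end Equiv.Perm

namespace IsSpin

variable {G α V : Type*} [Group G] [Fintype α] [DecidableEq α] [AddCommGroup V] [Module ℂ V]
  {π : G →* Perm α} {ρ : G →* Module.End ℂ V}

theorem eFull_of_model [FiniteDimensional ℂ V] (S : IsSpin π ρ) {h : G} {β : Type*} [Fintype β]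
    [DecidableEq β] {σ δ a : Perm β} {x y w u : β} {p q : ℕ} (hp : Odd p) (hq : orderOf σ = 2 * q)
    (hσ : σ.support = Finset.univ) (hσh : σ.cycleType = (π h).cycleType)
    (hσs : σ.sign = 1) (hδs : δ.sign = 1) (has : a.sign = 1) (hδp : δ ^ p = 1)
    (hdiv : ∀ s < 2 * q, 0 < s → ∃ m < 2 * q, s * m % (2 * q) = q)
    (hinv : σ ^ q * δ = δ⁻¹ * σ ^ q)
    (hcomm : ∀ j < 2 * q, σ ^ j * δ * (σ ^ j)⁻¹ * δ = δ * (σ ^ j * δ * (σ ^ j)⁻¹))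
    (hxy : x ≠ y) (hxw : x ≠ w) (hyw : y ≠ w) (hux : u ≠ x) (huy : u ≠ y) (huw : u ≠ w)
    (ha : a * δ * a⁻¹ * δ⁻¹ = swap x y * swap y w) : EFull π ρ h (π h).support := by
  obtain ⟨Φ, e, he, hΦσ, hΦs, heσ⟩ := Perm.exists_hom_of_cycleType_eq hσ hσh
  have hsub : ∀ τ, (Φ τ).support ⊆ (π h).support := fun τ => by
    induction τ using Perm.swap_induction_on with
    | one => simp
    | swap_mul τ x y hxy ih =>
      rw [map_mul, hΦs]
      exact support_mul_subset (support_swap_subset (heσ x) (heσ y)) ih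
  have hsign : ∀ τ, (Φ τ).sign = τ.sign := fun τ => by
    induction τ using Perm.swap_induction_on with
    | one => simp
    | swap_mul τ x y hxy ih =>
      rw [map_mul, map_mul, map_mul, ih, hΦs, Perm.sign_swap hxy, Perm.sign_swap (he.ne hxy)]
  obtain ⟨d, hd, hdp⟩ := S.exists_odd_lift hp (τ := Φ δ) (by rw [← map_pow, hδp, map_one])
  obtain ⟨b, hb⟩ := S.surj (Φ a)
  refine S.eFull_of_inverted hp hdp (by rw [hd, hsign, hδs]) (by rw [← hΦσ, hsign, hσs])
    (q := q) ?_ hdiv ?_ ?_ subset_rfl (hd ▸ hsub δ) ?_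
  · rw [← Perm.lcm_cycleType, ← hσh, Perm.lcm_cycleType, hq]
  · rw [mul_inv_eq_iff_eq_mul, hd, ← hΦσ, ← map_pow, ← map_mul, hinv, map_mul, map_inv]
  · intro j hj
    have := congrArg Φ (hcomm j hj)
    simp only [map_mul, map_inv, map_pow, hΦσ, ← hd] at this
    exact this
  · intro W hW0 hW
    refine S.nontrivial_of_commutator hW0 hW (heσ x) (heσ y) (heσ w) (heσ u) (he.ne hxy)
      (he.ne hxw) (he.ne hyw) (he.ne hux) (he.ne huy) (he.ne huw) (a := b) ?_ ?_
    · refine hW b⁻¹ ?_ ?_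
      · rw [map_inv, Perm.support_inv, hb]; exact hsub a
      · rw [map_inv, map_inv, hb, hsign, has, inv_one]
    · rw [map_mul, map_mul, map_mul, map_inv, map_inv, hb, hd, ← hΦs, ← hΦs,
        ← map_mul Φ (swap x y), ← ha]
      simp only [map_mul, map_inv]

theorem eFull_two_four [FiniteDimensional ℂ V] (S : IsSpin π ρ) {h : G}
    (hct : (π h).cycleType = {2, 4}) : EFull π ρ h (π h).support := by
  have hσ : (swap 0 1 * List.formPerm [2, 3, 4, 5] : Perm (Fin 6)).cycleType =
      {2, 4} := by
    rw [Perm.Disjoint.cycleType_mul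
      (Perm.disjoint_iff_disjoint_support.2 (by decide +kernel)),
      (Perm.isCycle_swap (by decide)).cycleType,
      (List.isCycle_formPerm (by decide) (by decide)).cycleType]
    decide +kernel
  refine S.eFull_of_model (δ := List.formPerm [2, 4, 0]) (a := swap 2 4 * swap 1 3)
    (x := 2) (y := 4) (w := 0) (u := 1) (p := 3) (q := 2) (by decide) ?_ ?_ (hσ.trans hct.symm)
    ?_ ?_ ?_ ?_ ?_ ?_ ?_ ?_ ?_ ?_ ?_ ?_ ?_ ?_
  · rw [← Perm.lcm_cycleType, hσ]
    decide
  all_goals decide +kernel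

theorem eFull_four_eight [FiniteDimensional ℂ V] (S : IsSpin π ρ) {h : G}
    (hct : (π h).cycleType = {4, 8}) : EFull π ρ h (π h).support := by
  have hσ : (List.formPerm [0, 1, 2, 3] * List.formPerm [4, 5, 6, 7, 8, 9, 10, 11] :
      Perm (Fin 12)).cycleType =
      {4, 8} := by
    rw [Perm.Disjoint.cycleType_mul
      (Perm.disjoint_iff_disjoint_support.2 (by decide +kernel)),
      (List.isCycle_formPerm (by decide) (by decide)).cycleType,
      (List.isCycle_formPerm (by decide) (by decide)).cycleType]
    decide +kernel
  refine S.eFull_of_model (δ := List.formPerm [4, 8, 0]) (a := swap 4 8 * swap 1 2)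
    (x := 4) (y := 8) (w := 0) (u := 1) (p := 3) (q := 4) (by decide) ?_ ?_ (hσ.trans hct.symm)
    ?_ ?_ ?_ ?_ ?_ ?_ ?_ ?_ ?_ ?_ ?_ ?_ ?_ ?_
  · rw [← Perm.lcm_cycleType, hσ]
    decide
  all_goals decide +kernel

theorem eFull_two_eight [FiniteDimensional ℂ V] (S : IsSpin π ρ) {h : G}
    (hct : (π h).cycleType = {2, 8}) : EFull π ρ h (π h).support := by
  have hσ : (swap 0 1 * List.formPerm [2, 3, 4, 5, 6, 7, 8, 9] : Perm (Fin 10)).cycleType =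
      {2, 8} := by
    rw [Perm.Disjoint.cycleType_mul
      (Perm.disjoint_iff_disjoint_support.2 (by decide +kernel)),
      (Perm.isCycle_swap (by decide)).cycleType,
      (List.isCycle_formPerm (by decide) (by decide)).cycleType]
    decide +kernel
  refine S.eFull_of_model (δ := List.formPerm [0, 2, 4, 8, 6]) (a := swap 0 2 * swap 1 3)
    (x := 0) (y := 2) (w := 4) (u := 1) (p := 5) (q := 4) (by decide) ?_ ?_ (hσ.trans hct.symm)
    ?_ ?_ ?_ ?_ ?_ ?_ ?_ ?_ ?_ ?_ ?_ ?_ ?_ ?_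
  · rw [← Perm.lcm_cycleType, hσ]
    decide
  all_goals decide +kernel

theorem neg_eigenvector_of_full [FiniteDimensional ℂ V] (S : IsSpin π ρ) {g h : G}
    (hd : (π h).Disjoint (π (h⁻¹ * g))) (he : Even (orderOf (π h)))
    (hF : Full π ρ h (π h).support ∧ (π (h⁻¹ * g)).sign = 1 ∨
      EFull π ρ h (π h).support ∧ (π h).sign = 1) {v : V} {κ : ℂ} (hv : v ≠ 0)
    (hκ : ρ g v = κ • v) : ∃ w : V, w ≠ 0 ∧ ρ g w = (-κ) • w := by
  set r := h⁻¹ * g with hr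
  have hg : g = h * r := by rw [hr, mul_inv_cancel_left]
  have hcomm : ρ h * ρ r = ρ r * ρ h := by
    rcases hF with hF | hF
    · exact S.comm_of_sign_right hd hF.2
    · exact S.comm_of_sign_left hd hF.2
  have hgr : ρ g * ρ r = ρ r * ρ g := by rw [hg, map_mul, ← mul_assoc, ← hcomm]
  obtain ⟨u, hu, hu0, μ, hμ⟩ := Module.End.exists_eigenvector_mem (T := ρ r)
    (Module.End.inf_eigenspace_ne_bot (W := ⊤) trivial hv hκ) (by
      rintro v ⟨-, hv⟩
      refine ⟨trivial, Module.End.mem_eigenspace_iff.2 ?_⟩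
      rw [← Module.End.mul_apply, hgr, Module.End.mul_apply, Module.End.mem_eigenspace_iff.1 hv,
        map_smul])
  have hκu := Module.End.mem_eigenspace_iff.1 hu.2
  have hμ0 : μ ≠ 0 := eigen_ne_zero hu0 hμ
  have hhu : ρ h u = (μ⁻¹ * κ) • u := by
    rw [hg, rho_mul_apply, hμ, map_smul] at hκu
    rw [mul_smul, ← hκu, smul_smul, inv_mul_cancel₀ hμ0, one_smul]
  obtain ⟨ν, hν⟩ := S.exists_root h
  have hν' : ρ h ^ orderOf (π h) =
      (-(μ⁻¹ * κ)) ^ orderOf (π h) • (1 : Module.End ℂ V) := by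
    have h1 := rho_pow_eigen hhu (orderOf (π h))
    rw [map_pow, hν, LinearMap.smul_apply, Module.End.one_apply] at h1
    rw [hν, he.neg_pow, smul_left_injective ℂ hu0 h1]
  have hW0 := Module.End.inf_eigenspace_ne_bot (W := ⊤) trivial hu0 hμ
  have hdis : Disjoint (π r).support (π h).support :=
    (Perm.disjoint_iff_disjoint_support.1 hd).symm
  obtain ⟨w, hw, hw0, hwν⟩ : ∃ w ∈ ⊤ ⊓ (ρ r).eigenspace μ, w ≠ 0 ∧
      ρ h w = (-(μ⁻¹ * κ)) • w := by
    rcases hF with hF | hF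
    · exact hF.1 _ hW0 (S.inv_inf_eigenspace (W := ⊤) (D := Finset.univ) hF.2
        (fun _ _ _ _ => trivial)
        (Finset.subset_univ _) hdis μ) _ hν'
    · exact hF.1 _ hW0 (S.eInv_inf_eigenspace (W := ⊤) (D := Finset.univ) (fun _ _ _ _ _ => trivial)
        (Finset.subset_univ _) hdis μ) _ hν'
  refine ⟨w, hw0, ?_⟩
  rw [hg, rho_mul_apply, Module.End.mem_eigenspace_iff.1 hw.2, map_smul, hwν, smul_smul, mul_neg,
    mul_inv_cancel_left₀ hμ0]

theorem full_of_isCycle [FiniteDimensional ℂ V] (S : IsSpin π ρ) {c : G} (hc : (π c).IsCycle)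
    (he : Even (π c).support.card) (hl : (π c).support.card ∉ ({2, 4, 6, 8} : Finset ℕ)) :
    Full π ρ c (π c).support := by
  have h2 := hc.two_le_card_support
  rcases Nat.eq_two_pow_or_exists_odd_prime_and_dvd (π c).support.card with
    ⟨e, h⟩ | ⟨p, hp, ⟨r, hr⟩, hp2⟩
  · have he4 : 4 ≤ e := by
      by_contra! hlt
      rw [h] at hl he
      interval_cases e <;> revert hl he <;> decide
    obtain ⟨k, rfl⟩ := Nat.exists_eq_add_of_le he4
    refine S.full_of_four_dvd (r := 2 ^ (k + 2)) hc ?_ ?_ (by rw [h]; ring)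
    · exact (even_two).pow_of_ne_zero (by omega)
    · have := Nat.one_le_two_pow (n := k)
      rw [pow_add]; omega
  · have hr2 : Even r := by
      rw [hr, Nat.even_mul] at he
      exact he.resolve_left (Nat.not_even_iff_odd.2 hp2)
    refine S.full_of_odd_prime hc hp hp2 hr2 (Nat.pos_of_ne_zero ?_) ?_ hr
    · rintro rfl; omega
    · rintro rfl rfl
      rw [hr] at hl
      exact hl (by decide)

theorem sign_eq_neg_one_pow_card {σ : Perm α} (he : ∀ l ∈ σ.cycleType, Even l) :
    σ.sign = (-1) ^ Multiset.card σ.cycleType := by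
  have hs : Even σ.cycleType.sum := Multiset.sum_induction _ _ (fun _ _ => Even.add) (by simp) he
  rw [Perm.sign_of_cycleType, pow_add, hs.neg_one_pow, one_mul]

theorem exists_neg_eigenvector [FiniteDimensional ℂ V] (S : IsSpin π ρ) {g : G}
    (he : ∀ l ∈ (π g).cycleType, Even l) (hparts : 2 ≤ Multiset.card (π g).cycleType)
    (hdist : (π g).cycleType.Nodup) {v : V} {κ : ℂ} (hv : v ≠ 0) (hκ : ρ g v = κ • v) :
    ∃ w : V, w ≠ 0 ∧ ρ g w = (-κ) • w := by
  rcases Int.units_eq_one_or (π g).sign with hs | hs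
  · obtain ⟨l, hl⟩ := Multiset.card_pos_iff_exists_mem.1 (two_pos.trans_le hparts)
    have hle := he l hl
    rw [Perm.cycleType_def, Multiset.mem_map] at hl
    obtain ⟨c, hc, rfl⟩ := hl
    obtain ⟨c, rfl⟩ := S.surj c
    have hcs := sign_of_isCycle (Perm.mem_cycleFactorsFinset_iff.1 hc).1 hle
    have h1 := LinearMap.congr_fun (S.cycleFactor_anticomm hs hc hcs) v
    refine ⟨ρ c v, rho_ne_zero c hv, ?_⟩
    rw [LinearMap.neg_apply, Module.End.mul_apply, Module.End.mul_apply, hκ, map_smul] at h1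
    rw [neg_smul, h1, neg_neg]
  by_cases hbig : ∃ l ∈ (π g).cycleType, l ∉ ({2, 4, 6, 8} : Finset ℕ)
  · obtain ⟨l, hl, hl8⟩ := hbig
    have hle := he l hl
    obtain ⟨c, τ, hg, hd, hc, rfl⟩ := Perm.mem_cycleType_iff.1 hl
    obtain ⟨c, rfl⟩ := S.surj c
    have hτ : π (c⁻¹ * g) = τ := by rw [map_mul, map_inv, hg, inv_mul_cancel_left]
    have hcs := sign_of_isCycle hc hle
    refine S.neg_eigenvector_of_full (h := c) (hτ ▸ hd) (by rwa [hc.orderOf])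
      (Or.inl ⟨S.full_of_isCycle hc hle hl8, ?_⟩) hv hκ
    rw [map_mul, map_mul, map_inv, map_inv, hs, hcs]
    rfl
  have key : ∀ l₁ ∈ (π g).cycleType, ∀ l₂ ∈ (π g).cycleType, l₁ ≠ l₂ →
      (∀ h : G, (π h).cycleType = {l₁, l₂} → EFull π ρ h (π h).support) →
      ∃ w : V, w ≠ 0 ∧ ρ g w = (-κ) • w := by
    intro l₁ hl₁ l₂ hl₂ hne hF
    have hle₁ := he l₁ hl₁
    have hle₂ := he l₂ hl₂
    obtain ⟨c₁, τ, hg, hd, hc₁, rfl⟩ := Perm.mem_cycleType_iff.1 hl₁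
    rw [hg, hd.cycleType_mul, hc₁.cycleType, Multiset.mem_add, Multiset.mem_singleton] at hl₂
    obtain ⟨c₂, τ', rfl, hd', hc₂, rfl⟩ := Perm.mem_cycleType_iff.1 (hl₂.resolve_left hne.symm)
    rw [Perm.disjoint_iff_disjoint_support, hd'.support_mul, Finset.disjoint_union_right,
      ← Perm.disjoint_iff_disjoint_support, ← Perm.disjoint_iff_disjoint_support] at hd
    obtain ⟨h, hh⟩ := S.surj (c₁ * c₂)
    have hct : (π h).cycleType = {c₁.support.card, c₂.support.card} := by
      rw [hh, hd.1.cycleType_mul, hc₁.cycleType, hc₂.cycleType]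
      rfl
    have hτ : π (h⁻¹ * g) = τ' := by
      rw [map_mul, map_inv, hh, hg, ← mul_assoc c₁, inv_mul_cancel_left]
    have hsh : (π h).sign = 1 := by
      rw [hh, map_mul, sign_of_isCycle hc₁ hle₁, sign_of_isCycle hc₂ hle₂]
      rfl
    refine S.neg_eigenvector_of_full (h := h) ?_ ?_ (Or.inr ⟨hF h hct, hsh⟩) hv hκ
    · rw [hτ, hh]
      exact hd.2.mul_left hd'
    · rw [← Perm.lcm_cycleType, hct]
      exact even_iff_two_dvd.2 (hle₁.two_dvd.trans (Multiset.dvd_lcm (by simp)))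
  push Not at hbig
  have h3 : 3 ≤ Multiset.card (π g).cycleType := by
    rw [sign_eq_neg_one_pow_card he] at hs
    by_contra! hlt
    rw [show Multiset.card (π g).cycleType = 2 by omega] at hs
    exact absurd hs (by decide)
  have hsel : ∀ F ∈ ({2, 4, 6, 8} : Finset ℕ).powerset, 3 ≤ F.card →
      (2 ∈ F ∧ 4 ∈ F) ∨ (4 ∈ F ∧ 8 ∈ F) ∨ (2 ∈ F ∧ 8 ∈ F) := by decide
  rcases hsel ⟨_, hdist⟩ (Finset.mem_powerset.2 hbig) h3 with h | h | h
  · exact key 2 h.1 4 h.2 (by decide) fun _ => S.eFull_two_four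
  · exact key 4 h.1 8 h.2 (by decide) fun _ => S.eFull_four_eight
  · exact key 2 h.1 8 h.2 (by decide) fun _ => S.eFull_two_eight

theorem exists_eigenvector_of_pow [FiniteDimensional ℂ V] [Nontrivial V] (S : IsSpin π ρ) {g : G}
    (hfix : (π g).support = Finset.univ) (he : ∀ l ∈ (π g).cycleType, Even l)
    (hparts : 2 ≤ Multiset.card (π g).cycleType) (hdist : (π g).cycleType.Nodup) {κ : ℂ}
    (hκ : ρ g ^ orderOf (π g) = κ ^ orderOf (π g) • (1 : Module.End ℂ V)) :
    ∃ v : V, v ≠ 0 ∧ ρ g v = κ • v := by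
  have heven : 2 ∣ orderOf (π g) := by
    obtain ⟨l, hl⟩ := Multiset.card_pos_iff_exists_mem.1 (two_pos.trans_le hparts)
    rw [← Perm.lcm_cycleType]
    exact (he l hl).two_dvd.trans (Multiset.dvd_lcm hl)
  have ho : 2 * orderOf (π (g * g)) = orderOf (π g) := by
    rw [map_mul, ← pow_two, orderOf_pow_of_dvd two_ne_zero heven, Nat.mul_div_cancel' heven]
  obtain ⟨v, -, hv0, hv⟩ := S.full_mul_self_univ hfix he hparts hdist ⊤ top_ne_bot
    (fun _ _ _ _ => trivial) (κ ^ 2) (by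
      rw [← ho, pow_mul, pow_mul] at hκ
      rw [map_mul ρ, ← pow_two, hκ])
  rw [rho_mul_apply] at hv
  rcases eigen_or_neg (T := ρ g) (W := ⊤) (fun _ _ => trivial) trivial hv0 hv with
    ⟨w, -, hw0, hw⟩ | ⟨w, -, hw0, hw⟩
  · exact ⟨w, hw0, hw⟩
  · obtain ⟨u, hu0, hu⟩ := S.exists_neg_eigenvector he hparts hdist hw0 hw
    exact ⟨u, hu0, by rwa [neg_neg] at hu⟩

end IsSpin

open Polynomial in
theorem minpoly_eq_X_pow_sub_C {V : Type*} [AddCommGroup V] [Module ℂ V] [FiniteDimensional ℂ V]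
    {T : Module.End ℂ V} {k : ℕ} {ε : ℂ} (hk : k ≠ 0) (hε : ε ≠ 0)
    (hT : T ^ k = ε • (1 : Module.End ℂ V))
    (h : ∀ κ : ℂ, κ ^ k = ε → ∃ v : V, v ≠ 0 ∧ T v = κ • v) : minpoly ℂ T = X ^ k - C ε := by
  have hmon := monic_X_pow_sub_C ε hk
  have h_int : IsIntegral ℂ T := Algebra.IsIntegral.isIntegral T
  refine eq_of_monic_of_associated (minpoly.monic h_int) hmon (associated_of_dvd_dvd ?_ ?_)
  · refine minpoly.dvd ℂ T ?_
    rw [map_sub, map_pow, aeval_X, aeval_C, hT, Algebra.algebraMap_eq_smul_one, sub_self]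
  · rw [IsAlgClosed.dvd_iff_roots_le_roots hmon.ne_zero (minpoly.ne_zero h_int),
      Multiset.le_iff_subset (nodup_roots
        ((separable_X_pow_sub_C ε (Nat.cast_ne_zero.2 hk) hε)))]
    intro κ hκ
    rw [mem_roots hmon.ne_zero, IsRoot.def, eval_sub, eval_pow, eval_X, eval_C, sub_eq_zero] at hκ
    obtain ⟨v, hv0, hv⟩ := h κ hκ
    rw [mem_roots (minpoly.ne_zero h_int)]
    exact Module.End.isRoot_of_hasEigenvalue (Module.End.hasEigenvalue_of_hasEigenvector
      ⟨Module.End.mem_eigenspace_iff.2 hv, hv0⟩)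

end

open Schur Polynomial in
/-- Theorem: for `g ∈ S̃_n` such that `π(g)` has no fixed points, has at least two cycles,
and all its cycle lengths are even and pairwise distinct, the minimal polynomial of
`ρ(g)` in every irreducible spin representation `(ρ, V)` of `S̃_n` is `X^k − ε_g`, where
`k` is the order of `π(g)`. -/
theorem schur_minpoly_distinct_even_cycles (n : ℕ) (hn : 2 ≤ n)
    (π : Cover n →* Equiv.Perm (Fin n))
    (hπt : ∀ i : Fin (n - 1), π (t n i) = adj n i)
    (hπz : π (z n) = 1)
    (g : Cover n)
    (hfix : (π g).support = Finset.univ)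
    (hparts : 2 ≤ Multiset.card (π g).cycleType)
    (heven : ∀ l ∈ (π g).cycleType, Even l)
    (hdistinct : (π g).cycleType.Nodup)
    (k : ℕ) (hk : k = orderOf (π g))
    (V : Type) [AddCommGroup V] [Module ℂ V] [FiniteDimensional ℂ V] [Nontrivial V]
    (ρ : Cover n →* Module.End ℂ V)
    (hirr : ∀ U : Submodule ℂ V, (∀ h : Cover n, U.map (ρ h) ≤ U) → U = ⊥ ∨ U = ⊤)
    (hspin : ρ (z n) = -1)
    (ε : ℂ) (hε : (g ^ k = 1 ∧ ε = 1) ∨ (g ^ k = z n ∧ ε = -1)) :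
    minpoly ℂ (ρ g) = X ^ k - C ε := by
  have S := Schur.isSpin hn hπt hπz ρ hspin
  have hpow : ρ g ^ k = ε • (1 : Module.End ℂ V) := by
    rcases hε with ⟨h, rfl⟩ | ⟨h, rfl⟩
    · rw [← map_pow, h, map_one, one_smul]
    · rw [← map_pow, h, hspin, neg_one_smul]
  have hε0 : ε ≠ 0 := by
    rcases hε with ⟨-, rfl⟩ | ⟨-, rfl⟩ <;> norm_num
  subst hk
  refine minpoly_eq_X_pow_sub_C (orderOf_pos _).ne' hε0 hpow fun κ hκ => ?_
  exact S.exists_eigenvector_of_pow hfix heven hparts hdistinct (by rw [hpow, hκ])
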